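/- arXiv:2003.07511 — 2 statements merged into one kernel-verified Lean document; each statement's English description precedes it below -/
import Mathlib

section
/- Let G be a triangle-free simple graph of order n_G such that the Seidel matrix of the disjoint union G ∪ 2K_2 has smallest eigenvalue at least −5, and assume the independence number of G satisfies α(G) ≤ 26. Then (i) n_G ≤ 68; and (ii) if n_G ≥ 66, then there exists an edge xy of G with deg_G(x) + deg_G(y) ≤ 20. -/
open Matrix

/-- A Seidel matrix: symmetric, zero diagonal, off-diagonal entries `±1`. -/
def IsSeidel {n : ℕ} (S : Matrix (Fin n) (Fin n) ℝ) : Prop :=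
  S.IsSymm ∧ (∀ i, S i i = 0) ∧ ∀ i j, i ≠ j → S i j = 1 ∨ S i j = -1

/-- Smallest eigenvalue of a real symmetric matrix (junk value `0` if not Hermitian). -/
noncomputable def minEig {m : Type*} [Fintype m] [DecidableEq m] (A : Matrix m m ℝ) : ℝ := by
  classical
  exact if hA : A.IsHermitian then ⨅ i, hA.eigenvalues i else 0

/-- Largest eigenvalue of a real symmetric matrix (junk value `0` if not Hermitian). -/
noncomputable def maxEig {m : Type*} [Fintype m] [DecidableEq m] (A : Matrix m m ℝ) : ℝ := by
  classical
  exact if hA : A.IsHermitian then ⨆ i, hA.eigenvalues i else 0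

/-- The Seidel matrix of a simple graph `G`, i.e. `J - I - 2A(G)`:
zero diagonal, `-1` on adjacent pairs, `1` on distinct non-adjacent pairs. -/
noncomputable def seidelOf {V : Type*} [Fintype V] (G : SimpleGraph V) : Matrix V V ℝ := by
  classical
  exact Matrix.of fun i j => if i = j then 0 else if G.Adj i j then -1 else 1

/-- Smallest eigenvalue of the Seidel matrix of a finite graph. -/
noncomputable def minSeidelEig {V : Type*} [Finite V] (G : SimpleGraph V) : ℝ := by
  classical
  letI := Fintype.ofFinite V
  exact minEig (seidelOf G)

/-- Spectral radius (largest adjacency eigenvalue) of a finite graph. -/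
noncomputable def specRad {V : Type*} [Finite V] (G : SimpleGraph V) : ℝ := by
  classical
  letI := Fintype.ofFinite V
  exact maxEig (G.adjMatrix ℝ)

/-- Switching equivalence: `T = D S D` for some diagonal `±1` matrix `D`. -/
def SwEquiv {n : ℕ} (S T : Matrix (Fin n) (Fin n) ℝ) : Prop :=
  ∃ ε : Fin n → ℝ, (∀ i, ε i = 1 ∨ ε i = -1) ∧
    T = Matrix.diagonal ε * S * Matrix.diagonal ε

/-- The switching graph of a Seidel matrix `S`: the graph on `2n` vertices whose Seidel
matrix is the block matrix `((S, I - S), (I - S, S))`, adjacency given by entries `-1`. -/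
def switchGraph {n : ℕ} (S : Matrix (Fin n) (Fin n) ℝ) : SimpleGraph (Fin n ⊕ Fin n) :=
  SimpleGraph.fromRel fun x y => Matrix.fromBlocks S (1 - S) (1 - S) S x y = -1

/-- Independence number of a graph. -/
noncomputable def indepNum {V : Type*} (G : SimpleGraph V) : ℕ := Gᶜ.cliqueNum

/-- The graph consisting of `t` disjoint copies of `K₂`. -/
def nK2 (t : ℕ) : SimpleGraph (Fin t × Fin 2) :=
  SimpleGraph.fromRel fun p q => p.1 = q.1

section Core
variable {V : Type*} [Fintype V] [DecidableEq V] (G : SimpleGraph V) [DecidableRel G.Adj]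

/-- Adjacency bilinear form. -/
def BF (u v : V → ℝ) : ℝ := ∑ i, ∑ j, if G.Adj i j then u i * v j else 0

/-- The spectral condition in quadratic form. -/
def QF : Prop := ∀ u : V → ℝ, BF G u u ≤ 2 * ∑ i, u i ^ 2 + (∑ i, u i) ^ 2 / 6

/-- Indicator vector. -/
def ind (S : Finset V) : V → ℝ := fun i => if i ∈ S then 1 else 0

/-- Number of ordered adjacent pairs. -/
def EE (S T : Finset V) : ℕ := ∑ s ∈ S, (T.filter (G.Adj s)).card

lemma BF_add_left (u v w : V → ℝ) : BF G (u + v) w = BF G u w + BF G v w := by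
  unfold BF
  rw [← Finset.sum_add_distrib]
  refine Finset.sum_congr rfl fun i _ => ?_
  rw [← Finset.sum_add_distrib]
  refine Finset.sum_congr rfl fun j _ => ?_
  split_ifs <;> simp [add_mul]

lemma BF_comm (u v : V → ℝ) : BF G u v = BF G v u := by
  unfold BF
  rw [Finset.sum_comm]
  refine Finset.sum_congr rfl fun i _ => Finset.sum_congr rfl fun j _ => ?_
  simp only [G.adj_comm i j, mul_comm]

lemma BF_add_right (u v w : V → ℝ) : BF G u (v + w) = BF G u v + BF G u w := by
  rw [BF_comm, BF_add_left, BF_comm G v, BF_comm G w]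

lemma BF_smul_left (c : ℝ) (u v : V → ℝ) : BF G (c • u) v = c * BF G u v := by
  unfold BF
  rw [Finset.mul_sum]
  refine Finset.sum_congr rfl fun i _ => ?_
  rw [Finset.mul_sum]
  refine Finset.sum_congr rfl fun j _ => ?_
  split_ifs <;> simp [mul_assoc]

lemma BF_smul_right (c : ℝ) (u v : V → ℝ) : BF G u (c • v) = c * BF G u v := by
  rw [BF_comm, BF_smul_left, BF_comm]

lemma BF_ind (S T : Finset V) : BF G (ind S) (ind T) = EE G S T := by
  unfold BF EE ind
  rw [Nat.cast_sum, ← Finset.sum_subset (Finset.subset_univ S)]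
  · refine Finset.sum_congr rfl fun i hi => ?_
    rw [Finset.card_filter, Nat.cast_sum, ← Finset.sum_subset (Finset.subset_univ T)]
    · refine Finset.sum_congr rfl fun j hj => ?_
      simp [hi, hj]
    · intro j _ hj; simp [hj]
  · intro i _ hi; simp [hi]

lemma EE_comm (S T : Finset V) : EE G S T = EE G T S := by
  have := BF_comm G (ind S) (ind T)
  rw [BF_ind, BF_ind] at this
  exact_mod_cast this

lemma sum_ind (S : Finset V) : ∑ i, ind S i = S.card := by
  simp [ind]

lemma sum_ind_mul (S T : Finset V) : ∑ i, ind S i * ind T i = (S ∩ T).card := by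
  simp only [ind, ← ite_and, mul_ite, mul_one, mul_zero]
  rw [Finset.sum_boole]
  congr 2
  ext i; simp [and_comm]

variable {G}

lemma EE_nbr_self (htf : G.CliqueFree 3) (x : V) :
    EE G (G.neighborFinset x) (G.neighborFinset x) = 0 := by
  unfold EE
  refine Finset.sum_eq_zero fun y hy => ?_
  rw [Finset.card_eq_zero, Finset.filter_eq_empty_iff]
  intro z hz hyz
  rw [SimpleGraph.mem_neighborFinset] at hy hz
  exact htf {x, y, z} (SimpleGraph.is3Clique_triple_iff.2 ⟨hy, hz, hyz⟩)

lemma EE_singleton (x : V) (T : Finset V) :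
    EE G {x} T = (G.neighborFinset x ∩ T).card := by
  unfold EE
  rw [Finset.sum_singleton]
  congr 1
  ext i; simp [and_comm]

lemma key (htf : G.CliqueFree 3) (hQ : QF G) (x : V) (T : Finset V) (p q t : ℝ) :
    2 * p * q * G.degree x + 2 * p * t * (G.neighborFinset x ∩ T).card
      + 2 * q * t * EE G (G.neighborFinset x) T + t ^ 2 * EE G T T
    ≤ 2 * (p ^ 2 + q ^ 2 * G.degree x + t ^ 2 * T.card + 2 * p * t * ({x} ∩ T).card
        + 2 * q * t * (G.neighborFinset x ∩ T).card)
      + (p + q * G.degree x + t * T.card) ^ 2 / 6 := by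
  have h := hQ (p • ind {x} + q • ind (G.neighborFinset x) + t • ind T)
  have e1 : ∑ i, (p • ind {x} + q • ind (G.neighborFinset x) + t • ind T) i
      = p + q * G.degree x + t * T.card := by
    simp only [Pi.add_apply, Pi.smul_apply, smul_eq_mul, Finset.sum_add_distrib,
      ← Finset.mul_sum, sum_ind]
    simp
  have e2 : ∑ i, ((p • ind {x} + q • ind (G.neighborFinset x) + t • ind T) i) ^ 2
      = p ^ 2 + q ^ 2 * G.degree x + t ^ 2 * T.card + 2 * p * t * ({x} ∩ T).card
        + 2 * q * t * (G.neighborFinset x ∩ T).card := by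
    have : ∀ i, ((p • ind {x} + q • ind (G.neighborFinset x) + t • ind T) i) ^ 2
       = p ^ 2 * (ind {x} i * ind {x} i)
        + q ^ 2 * (ind (G.neighborFinset x) i * ind (G.neighborFinset x) i)
        + t ^ 2 * (ind T i * ind T i) + 2 * p * t * (ind {x} i * ind T i)
        + 2 * q * t * (ind (G.neighborFinset x) i * ind T i)
        + 2 * p * q * (ind {x} i * ind (G.neighborFinset x) i) := by
      intro i
      simp only [Pi.add_apply, Pi.smul_apply, smul_eq_mul]; ring
    simp only [this, Finset.sum_add_distrib, ← Finset.mul_sum, sum_ind_mul]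
    simp
  rw [e1, e2] at h
  simp only [BF_add_left, BF_add_right, BF_smul_left, BF_smul_right, BF_ind] at h
  rw [EE_nbr_self htf, EE_comm G T {x}, EE_comm G T (G.neighborFinset x),
    EE_comm G (G.neighborFinset x) {x}, EE_singleton, EE_singleton, EE_singleton] at h
  have z : (G.neighborFinset x ∩ {x}) = ∅ := by
    ext i; simp
  rw [z, Finset.inter_self, SimpleGraph.card_neighborFinset_eq_degree] at h
  simp only [Finset.card_empty, Nat.cast_zero] at h
  linarith

end Core

section Core2
variable {V : Type*} [Fintype V] [DecidableEq V] {G : SimpleGraph V} [DecidableRel G.Adj]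

lemma EE_univ (S : Finset V) : EE G S Finset.univ = ∑ s ∈ S, G.degree s := by
  unfold EE
  refine Finset.sum_congr rfl fun s _ => ?_
  rw [← SimpleGraph.card_neighborFinset_eq_degree]
  congr 1
  ext i; simp

/-- Total degree. -/
abbrev S1 (G : SimpleGraph V) [DecidableRel G.Adj] : ℕ := EE G Finset.univ Finset.univ

/-- Sum of the degrees of the neighbours. -/
abbrev sn (G : SimpleGraph V) [DecidableRel G.Adj] (x : V) : ℕ :=
  EE G (G.neighborFinset x) Finset.univ

lemma keyI (htf : G.CliqueFree 3) (hQ : QF G) (x : V) (p q : ℝ) :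
    2 * p * q * G.degree x + 2 * p * G.degree x + 2 * q * sn G x + S1 G
    ≤ 2 * (p ^ 2 + q ^ 2 * G.degree x + Fintype.card V + 2 * p + 2 * q * G.degree x)
      + (p + q * G.degree x + Fintype.card V) ^ 2 / 6 := by
  have h := key htf hQ x Finset.univ p q 1
  simp only [Finset.inter_univ, SimpleGraph.card_neighborFinset_eq_degree,
    Finset.card_singleton, Finset.card_univ] at h
  simpa using h

lemma deg_le (htf : G.CliqueFree 3) (hQ : QF G) (x : V) : G.degree x ≤ 13 := by
  have h := key htf hQ x ∅ (5 * G.degree x) 13 0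
  simp at h
  by_contra hc
  push Not at hc
  have : (14 : ℝ) ≤ G.degree x := by exact_mod_cast hc
  nlinarith

/-- vertices at distance at least three from `x`. -/
def RR (G : SimpleGraph V) [DecidableRel G.Adj] (x : V) : Finset V :=
  Finset.univ.filter fun z => z ≠ x ∧ ¬ G.Adj x z ∧ ∀ y, G.Adj x y → ¬ G.Adj y z

lemma keyR (htf : G.CliqueFree 3) (hQ : QF G) (x : V) (k : ℕ) (hk : k ≤ (RR G x).card)
    (p q t : ℝ) :
    2 * p * q * G.degree x ≤ 2 * (p ^ 2 + q ^ 2 * G.degree x + t ^ 2 * k)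
      + (p + q * G.degree x + t * k) ^ 2 / 6 := by
  obtain ⟨T, hT, rfl⟩ := Finset.exists_subset_card_eq hk
  have h := key htf hQ x T p q t
  have e1 : G.neighborFinset x ∩ T = ∅ := by
    ext z; simp only [Finset.mem_inter, SimpleGraph.mem_neighborFinset, Finset.notMem_empty,
      iff_false, not_and]
    intro hz hzT
    have := hT hzT
    simp [RR] at this
    exact this.2.1 hz
  have e2 : {x} ∩ T = ∅ := by
    ext z; simp only [Finset.mem_inter, Finset.mem_singleton, Finset.notMem_empty,
      iff_false, not_and]
    intro hz hzT
    have := hT hzT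
    simp [RR] at this
    exact this.1 hz
  have e3 : EE G (G.neighborFinset x) T = 0 := by
    unfold EE
    refine Finset.sum_eq_zero fun y hy => ?_
    rw [Finset.card_eq_zero, Finset.filter_eq_empty_iff]
    intro z hz
    have := hT hz
    simp [RR] at this hy
    exact this.2.2 y hy
  rw [e1, e2, e3] at h
  have : (0 : ℝ) ≤ t ^ 2 * EE G T T := by positivity
  simp only [Finset.card_empty, Nat.cast_zero] at h
  linarith

lemma R_card (htf : G.CliqueFree 3) (hQ : QF G) (x : V) (d r : ℕ) (hd : G.degree x = d)
    (h : (d, r) ∈ [(5, 32), (6, 14), (7, 8), (8, 5), (9, 3), (10, 2), (11, 1), (12, 0)]) :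
    (RR G x).card ≤ r := by
  by_contra hc
  push Not at hc
  have hk := keyR htf hQ x (r + 1) hc
  rw [hd] at hk
  simp only [List.mem_cons, Prod.mk.injEq, List.not_mem_nil, or_false] at h
  rcases h with ⟨rfl, rfl⟩ | ⟨rfl, rfl⟩ | ⟨rfl, rfl⟩ | ⟨rfl, rfl⟩ | ⟨rfl, rfl⟩ | ⟨rfl, rfl⟩ |
    ⟨rfl, rfl⟩ | ⟨rfl, rfl⟩
  · have := hk (-14) (-6) 1; norm_num at this
  · have := hk (-8) (-3) 1; norm_num at this
  · have := hk (-6) (-2) 1; norm_num at this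
  · have := hk (-6) (-2) 1; norm_num at this
  · have := hk (-4) (-1) 1; norm_num at this
  · have := hk (-4) (-1) 1; norm_num at this
  · have := hk (-4) (-1) 1; norm_num at this
  · have := hk (-4) (-1) 1; norm_num at this

lemma count (x : V) (f : V → ℝ) (hf : ∀ z, 0 ≤ f z) :
    ∑ z, f z ≤ f x + ∑ z ∈ RR G x, f z + ∑ y ∈ G.neighborFinset x, f y
      + ∑ y ∈ G.neighborFinset x, ∑ z ∈ G.neighborFinset y, f z := by
  have h1 : ∑ y ∈ G.neighborFinset x, ∑ z ∈ G.neighborFinset y, f z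
      = ∑ z, ∑ y, if G.Adj x y ∧ G.Adj y z then f z else 0 := by
    rw [Finset.sum_comm]
    rw [← Finset.sum_subset (Finset.subset_univ (G.neighborFinset x))]
    · refine Finset.sum_congr rfl fun y hy => ?_
      rw [SimpleGraph.mem_neighborFinset] at hy
      simp only [hy, true_and]
      rw [← Finset.sum_filter]
      refine Finset.sum_congr ?_ fun _ _ => rfl
      ext z; simp
    · intro y _ hy
      rw [SimpleGraph.mem_neighborFinset] at hy
      simp [hy]
  have h2 : f x = ∑ z, if z = x then f z else 0 := by simp
  have h3 : ∑ z ∈ RR G x, f z = ∑ z, if z ∈ RR G x then f z else 0 := by simp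
  have h4 : ∑ z ∈ G.neighborFinset x, f z = ∑ z, if G.Adj x z then f z else 0 := by
    rw [← Finset.sum_filter]
    refine Finset.sum_congr ?_ fun _ _ => rfl
    ext z; simp
  rw [h1, h2, h3, h4, ← Finset.sum_add_distrib, ← Finset.sum_add_distrib,
    ← Finset.sum_add_distrib]
  refine Finset.sum_le_sum fun z _ => ?_
  have n1 : 0 ≤ (if z = x then f z else 0) := by split_ifs; exacts [hf z, le_rfl]
  have n2 : 0 ≤ (if z ∈ RR G x then f z else 0) := by split_ifs; exacts [hf z, le_rfl]
  have n3 : 0 ≤ (if G.Adj x z then f z else 0) := by split_ifs; exacts [hf z, le_rfl]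
  have n4 : 0 ≤ ∑ y, if G.Adj x y ∧ G.Adj y z then f z else 0 := by
    refine Finset.sum_nonneg fun y _ => ?_
    split_ifs; exacts [hf z, le_rfl]
  by_cases c1 : z = x
  · rw [if_pos c1] at *; linarith
  by_cases c3 : G.Adj x z
  · rw [if_pos c3] at *; linarith
  by_cases c2 : z ∈ RR G x
  · rw [if_pos c2] at *; linarith
  simp only [RR, Finset.mem_filter, Finset.mem_univ, true_and, not_and, not_forall] at c2
  obtain ⟨y, hy, hyz⟩ := c2 c1 c3
  push Not at hyz
  have : f z ≤ ∑ y, if G.Adj x y ∧ G.Adj y z then f z else 0 := by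
    calc f z = if G.Adj x y ∧ G.Adj y z then f z else 0 := by simp [hy, hyz]
      _ ≤ _ := Finset.single_le_sum (f := fun y => if G.Adj x y ∧ G.Adj y z then f z else 0)
        (fun y _ => by split_ifs; exacts [hf z, le_rfl]) (Finset.mem_univ y)
  linarith

lemma small_case (htf : G.CliqueFree 3) (hQ : QF G) (hn : Fintype.card V = 66) (x : V)
    (hmax : ∀ y, G.degree y ≤ G.degree x) (h5 : 5 ≤ G.degree x) (h7 : G.degree x ≤ 7) :
    False := by
  have h := count (G := G) x (fun _ => (1 : ℝ)) (fun _ => by norm_num)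
  simp only [Finset.sum_const, Finset.card_univ, hn, nsmul_eq_mul, mul_one,
    SimpleGraph.card_neighborFinset_eq_degree] at h
  have hs : ∑ y ∈ G.neighborFinset x, (G.degree y : ℝ) ≤ G.degree x * G.degree x := by
    calc _ ≤ ∑ y ∈ G.neighborFinset x, (G.degree x : ℝ) :=
          Finset.sum_le_sum fun y _ => by exact_mod_cast hmax y
      _ = _ := by simp
  have hR := R_card htf hQ x
  generalize hd : G.degree x = d at *
  interval_cases d
  · have : ((RR G x).card : ℝ) ≤ 32 := by exact_mod_cast hR 5 32 rfl (by simp)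
    norm_num at h hs; linarith
  · have : ((RR G x).card : ℝ) ≤ 14 := by exact_mod_cast hR 6 14 rfl (by simp)
    norm_num at h hs; linarith
  · have : ((RR G x).card : ℝ) ≤ 8 := by exact_mod_cast hR 7 8 rfl (by simp)
    norm_num at h hs; linarith

lemma stepD (hn : Fintype.card V = 66) (x : V) (D r : ℕ)
    (hx : G.degree x = D) (hmax : ∀ y, G.degree y ≤ D) (hr : (RR G x).card ≤ r)
    (β κ c : ℝ)
    (hy : ∀ y, 1 ≤ G.degree y →
      (D : ℝ) * G.degree y - sn G y ≤ κ + β * (D - G.degree y) - c * S1 G) :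
    66 * (D : ℝ) - S1 G ≤ D * (κ - c * S1 G) + (1 + β) * (D ^ 2 - sn G x) + r * D := by
  have h := count (G := G) x (fun z => (D : ℝ) - G.degree z)
    (fun z => by have : (G.degree z : ℝ) ≤ D := by exact_mod_cast hmax z
                 linarith)
  have a1 : ∑ z, ((D : ℝ) - G.degree z) = 66 * D - S1 G := by
    rw [Finset.sum_sub_distrib, S1, EE_univ]
    simp [hn]
  have a2 : ∑ z ∈ RR G x, ((D : ℝ) - G.degree z) ≤ r * D := by
    calc _ ≤ ∑ z ∈ RR G x, (D : ℝ) := Finset.sum_le_sum fun z _ => by simp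
      _ = (RR G x).card * D := by simp
      _ ≤ _ := by
        have : ((RR G x).card : ℝ) ≤ r := by exact_mod_cast hr
        gcongr
  have gen : ∀ y, ∑ z ∈ G.neighborFinset y, ((D : ℝ) - G.degree z)
      = D * G.degree y - sn G y := by
    intro y
    rw [Finset.sum_sub_distrib, sn, EE_univ]
    simp [mul_comm]
  rw [a1, gen x, hx, Finset.sum_congr rfl (fun y _ => gen y)] at h
  have a3 : ∑ y ∈ G.neighborFinset x, ((D : ℝ) * G.degree y - sn G y)
      ≤ ∑ y ∈ G.neighborFinset x, (κ + β * (D - G.degree y) - c * S1 G) := by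
    refine Finset.sum_le_sum fun y hyx => hy y ?_
    rw [SimpleGraph.mem_neighborFinset] at hyx
    rw [Nat.one_le_iff_ne_zero, ← Nat.pos_iff_ne_zero, SimpleGraph.degree_pos_iff_exists_adj]
    exact ⟨x, hyx.symm⟩
  have a4 : ∑ y ∈ G.neighborFinset x, (κ + β * (D - G.degree y) - c * S1 G)
      = D * (κ - c * S1 G) + β * (D ^ 2 - sn G x) := by
    rw [Finset.sum_sub_distrib, Finset.sum_add_distrib, ← Finset.mul_sum, gen x]
    simp [hx]; ring
  nlinarith

lemma S1_le (hn : Fintype.card V = 66) (D : ℕ) (hmax : ∀ y, G.degree y ≤ D) :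
    (S1 G : ℝ) ≤ 66 * D := by
  rw [S1, EE_univ]
  have : ∑ s, G.degree s ≤ 66 * D := by
    calc _ ≤ ∑ s : V, D := Finset.sum_le_sum fun y _ => hmax y
      _ = _ := by simp [hn]
  exact_mod_cast this

lemma case8 (htf : G.CliqueFree 3) (hQ : QF G) (hn : Fintype.card V = 66) (x : V)
    (hx : G.degree x = 8) (hmax : ∀ y, G.degree y ≤ 8) : False := by
  have h := stepD (G := G) hn x 8 5 hx hmax (R_card htf hQ x 8 5 hx (by simp))
    11 (2101 / 108) (1 / 18) ?_
  · have k := keyI htf hQ x (-32) (-10)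
    have hub := S1_le hn 8 hmax
    have : (0 : ℝ) ≤ S1 G := by positivity
    rw [hx, hn] at k
    push_cast at hub
    norm_num at h k
    linarith
  · intro y h1
    have k := keyI htf hQ y (-29) (-9)
    have h2 := hmax y
    rw [hn] at k
    generalize G.degree y = d at *
    interval_cases d <;> norm_num at * <;> linarith

lemma case9 (htf : G.CliqueFree 3) (hQ : QF G) (hn : Fintype.card V = 66) (x : V)
    (hx : G.degree x = 9) (hmax : ∀ y, G.degree y ≤ 9) : False := by
  have h := stepD (G := G) hn x 9 3 hx hmax (R_card htf hQ x 9 3 hx (by simp))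
    10 (616 / 27) (1 / 18) ?_
  · have k := keyI htf hQ x (-38) (-10)
    have hub := S1_le hn 9 hmax
    have : (0 : ℝ) ≤ S1 G := by positivity
    rw [hx, hn] at k
    push_cast at hub
    norm_num at h k
    linarith
  · intro y h1
    have k := keyI htf hQ y (-31) (-9)
    have h2 := hmax y
    rw [hn] at k
    generalize G.degree y = d at *
    interval_cases d <;> norm_num at * <;> linarith

lemma case10 (htf : G.CliqueFree 3) (hQ : QF G) (hn : Fintype.card V = 66) (x : V)
    (hx : G.degree x = 10) (hmax : ∀ y, G.degree y ≤ 10) : False := by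
  have h := stepD (G := G) hn x 10 2 hx hmax (R_card htf hQ x 10 2 hx (by simp))
    10 (111 / 4) (1 / 18) ?_
  · have k := keyI htf hQ x (-45) (-11)
    have hub := S1_le hn 10 hmax
    have : (0 : ℝ) ≤ S1 G := by positivity
    rw [hx, hn] at k
    push_cast at hub
    norm_num at h k
    linarith
  · intro y h1
    have k := keyI htf hQ y (-33) (-9)
    have h2 := hmax y
    rw [hn] at k
    generalize G.degree y = d at *
    interval_cases d <;> norm_num at * <;> linarith

lemma case11 (htf : G.CliqueFree 3) (hQ : QF G) (hn : Fintype.card V = 66) (x : V)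
    (hx : G.degree x = 11) (hmax : ∀ y, G.degree y ≤ 11) : False := by
  have h := stepD (G := G) hn x 11 1 hx hmax (R_card htf hQ x 11 1 hx (by simp))
    10 (925 / 27) (1 / 18) ?_
  · have k := keyI htf hQ x (-56) (-13)
    have hub := S1_le hn 11 hmax
    have : (0 : ℝ) ≤ S1 G := by positivity
    rw [hx, hn] at k
    push_cast at hub
    norm_num at h k
    linarith
  · intro y h1
    have k := keyI htf hQ y (-35) (-9)
    have h2 := hmax y
    rw [hn] at k
    generalize G.degree y = d at *
    interval_cases d <;> norm_num at * <;> linarith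

lemma case12 (htf : G.CliqueFree 3) (hQ : QF G) (hn : Fintype.card V = 66) (x : V)
    (hx : G.degree x = 12) (hmax : ∀ y, G.degree y ≤ 12) : False := by
  have h := stepD (G := G) hn x 12 0 hx hmax (R_card htf hQ x 12 0 hx (by simp))
    (23 / 2) (17413 / 456) (1 / 19) ?_
  · have k := keyI htf hQ x (-79) (-17)
    have hub := S1_le hn 12 hmax
    have : (0 : ℝ) ≤ S1 G := by positivity
    rw [hx, hn] at k
    push_cast at hub
    norm_num at h k
    linarith
  · intro y h1
    have k := keyI htf hQ y (-83 / 2) (-19 / 2)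
    have h2 := hmax y
    rw [hn] at k
    generalize G.degree y = d at *
    interval_cases d <;> norm_num at * <;> linarith

end Core2

section Core3
variable {V : Type*} [Fintype V] [DecidableEq V] {G : SimpleGraph V} [DecidableRel G.Adj]

lemma srg_false (h : G.IsSRGWith 66 13 0 3) : False := by
  classical
  set A := G.adjMatrix ℝ with hA
  set J : Matrix V V ℝ := Matrix.of 1 with hJ
  have h1 : A * A = (13 : ℝ) • (1 : Matrix V V ℝ) + (3 : ℝ) • Gᶜ.adjMatrix ℝ := by
    have := h.matrix_eq (α := ℝ)
    rw [pow_two] at this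
    rw [this, zero_smul, add_zero]
    simp only [← Nat.cast_smul_eq_nsmul ℝ]
    norm_num only
  have h2 : 1 + A + Gᶜ.adjMatrix ℝ = J := by
    have := SimpleGraph.one_add_adjMatrix_add_compl_adjMatrix_eq_of_one (G := G) (α := ℝ)
    rw [hA, hJ]
    rw [SimpleGraph.compl_adjMatrix_eq_adjMatrix_compl] at this
    convert this
  have h3 : A * A = (10 : ℝ) • (1 : Matrix V V ℝ) + (3 : ℝ) • J - (3 : ℝ) • A := by
    rw [h1, ← h2]; module
  have h4 : A * J = (13 : ℝ) • J := by
    ext i j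
    have := h.regular i
    simp [hA, hJ, SimpleGraph.adjMatrix_mul_apply, this]
  have h5 : J * A = (13 : ℝ) • J := by
    ext i j
    have := h.regular j
    simp [hA, hJ, SimpleGraph.mul_adjMatrix_apply, this]
  have h6 : J * J = (66 : ℝ) • J := by
    ext i j
    simp [hJ, Matrix.mul_apply, h.card]
  set E : Matrix V V ℝ := (1 / 7 : ℝ) • (A + (5 : ℝ) • 1 - (3 / 11 : ℝ) • J) with hE
  have hid : E * E = E := by
    rw [hE]
    simp only [Matrix.smul_mul, Matrix.mul_smul, add_mul, mul_add, sub_mul, mul_sub, h3, h4, h5, h6,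
      Matrix.mul_one, Matrix.one_mul]
    module
  have htr : E.trace = 312 / 7 := by
    have t1 : A.trace = 0 := by simp [hA, Matrix.trace]
    have t2 : J.trace = 66 := by simp [hJ, Matrix.trace, h.card]
    rw [hE, Matrix.trace_smul, Matrix.trace_sub, Matrix.trace_add, Matrix.trace_smul,
      Matrix.trace_smul, t1, t2, Matrix.trace_one, h.card]
    norm_num
  have hI : IsIdempotentElem (Matrix.toLin' E) := by
    unfold IsIdempotentElem
    rw [Module.End.mul_eq_comp, ← Matrix.toLin'_mul, hid]
  have := (LinearMap.IsIdempotentElem.isProj_range _ hI).trace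
  rw [Matrix.trace_toLin'_eq, htr] at this
  generalize Module.finrank ℝ (LinearMap.range (Matrix.toLin' E)) = k at this
  have : (312 : ℝ) = 7 * k := by linarith
  have : 312 = 7 * k := by exact_mod_cast this
  omega

lemma mu13 (htf : G.CliqueFree 3) (hQ : QF G) (x w : V) (hx : G.degree x = 13)
    (hne : w ≠ x) (hna : ¬ G.Adj x w) :
    (G.neighborFinset w ∩ G.neighborFinset x).card = 3 := by
  have h := fun t => key htf hQ x {w} 5 1 t
  have e1 : G.neighborFinset x ∩ {w} = ∅ := by
    ext z; simp only [Finset.mem_inter, SimpleGraph.mem_neighborFinset, Finset.notMem_empty,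
      iff_false, not_and, Finset.mem_singleton]
    rintro hz rfl; exact hna hz
  have e2 : {x} ∩ ({w} : Finset V) = ∅ := by
    ext z; simp only [Finset.mem_inter, Finset.mem_singleton, Finset.notMem_empty,
      iff_false, not_and]
    rintro rfl h; exact hne h.symm
  have e3 : G.neighborFinset w ∩ {w} = ∅ := by
    ext z; simp
  rw [e1, e2, EE_comm G _ {w}, EE_singleton, EE_singleton, e3, hx] at h
  generalize (G.neighborFinset w ∩ G.neighborFinset x).card = μ at *
  by_contra hc
  rcases lt_or_gt_of_ne hc with hc | hc
  · have h1 := h (-1 / 2)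
    have : (μ : ℝ) ≤ 2 := by exact_mod_cast Nat.le_of_lt_succ hc
    norm_num at h1
    linarith
  · have h1 := h (1 / 2)
    have : (4 : ℝ) ≤ μ := by exact_mod_cast hc
    norm_num at h1
    linarith

lemma nbr13 (htf : G.CliqueFree 3) (hQ : QF G) (hn : Fintype.card V = 66) (x : V)
    (hx : G.degree x = 13) (y : V) (hy : G.Adj x y) : G.degree y = 13 := by
  have hs : ∑ y ∈ G.neighborFinset x, G.degree y = ∑ y ∈ G.neighborFinset x, 13 := by
    rw [← EE_univ, EE_comm]
    have : ∀ w, (((G.neighborFinset x).filter (G.Adj w)).card : ℕ)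
        = if w = x then 13 else if G.Adj x w then 0 else 3 := by
      intro w
      have e : (G.neighborFinset x).filter (G.Adj w)
          = G.neighborFinset w ∩ G.neighborFinset x := by
        ext; simp [and_comm]
      split_ifs with h1 h2
      · rw [e, h1]; simp [hx]
      · rw [Finset.card_eq_zero, Finset.filter_eq_empty_iff]
        intro z hz hwz
        rw [SimpleGraph.mem_neighborFinset] at hz
        exact htf {x, w, z} (SimpleGraph.is3Clique_triple_iff.2 ⟨h2, hz, hwz⟩)
      · rw [e]; exact mu13 htf hQ x w hx h1 h2
    unfold EE
    rw [Finset.sum_congr rfl fun w _ => this w]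
    have c : ∀ w, (if w = x then 13 else if G.Adj x w then 0 else 3)
      + (if G.Adj x w then 3 else 0) = 3 + (if w = x then 10 else 0) := by
      intro w
      by_cases h1 : w = x
      · subst h1; simp
      · by_cases h2 : G.Adj x w <;> simp [h1, h2]
    have d := Finset.sum_congr (rfl : (Finset.univ : Finset V) = Finset.univ) fun w _ => c w
    rw [Finset.sum_add_distrib, Finset.sum_add_distrib, ← Finset.sum_filter,
      ← SimpleGraph.neighborFinset_eq_filter] at d
    simp [hn, hx] at d
    simp [hx]
    omega
  have := (Finset.sum_eq_sum_iff_of_le (fun y _ => deg_le htf hQ y)).1 hs y (by simpa using hy)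
  exact this

lemma case13 (htf : G.CliqueFree 3) (hQ : QF G) (hn : Fintype.card V = 66) (x : V)
    (hx : G.degree x = 13) : False := by
  have hreg : ∀ w, G.degree w = 13 := by
    intro w
    by_cases h1 : w = x
    · rw [h1, hx]
    by_cases h2 : G.Adj x w
    · exact nbr13 htf hQ hn x hx w h2
    have := mu13 htf hQ x w hx h1 h2
    obtain ⟨y, hy⟩ := Finset.card_pos.1 (by rw [this]; norm_num)
    simp only [Finset.mem_inter, SimpleGraph.mem_neighborFinset] at hy
    exact nbr13 htf hQ hn y (nbr13 htf hQ hn x hx y hy.2) w hy.1.symm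
  refine srg_false (G := G) ⟨hn, hreg, ?_, ?_⟩
  · intro v w hvw
    rw [Fintype.card_eq_zero_iff]
    refine ⟨fun ⟨z, hz⟩ => ?_⟩
    rw [SimpleGraph.mem_commonNeighbors] at hz
    exact htf {v, w, z} (SimpleGraph.is3Clique_triple_iff.2 ⟨hvw, hz.1, hz.2⟩)
  · intro v w hne hvw
    rw [← mu13 htf hQ v w (hreg v) hne.symm hvw, ← Set.toFinset_card]
    congr 1
    ext z; simp [SimpleGraph.mem_commonNeighbors, and_comm]

theorem stepA (htf : G.CliqueFree 3) (hQ : QF G) (hn : Fintype.card V = 66) (y : V) :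
    G.degree y ≤ 4 := by
  obtain ⟨x, -, hx⟩ := Finset.exists_max_image Finset.univ (fun z => G.degree z) ⟨y, Finset.mem_univ y⟩
  have hmax : ∀ z, G.degree z ≤ G.degree x := fun z => hx z (Finset.mem_univ z)
  by_contra hc
  have h5 : 5 ≤ G.degree x := by have := hmax y; omega
  have h13 := deg_le htf hQ x
  by_cases h7 : G.degree x ≤ 7
  · exact small_case htf hQ hn x hmax h5 h7
  have : G.degree x = 8 ∨ G.degree x = 9 ∨ G.degree x = 10 ∨ G.degree x = 11 ∨
    G.degree x = 12 ∨ G.degree x = 13 := by omega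
  rcases this with h | h | h | h | h | h
  · exact case8 htf hQ hn x h (h ▸ hmax)
  · exact case9 htf hQ hn x h (h ▸ hmax)
  · exact case10 htf hQ hn x h (h ▸ hmax)
  · exact case11 htf hQ hn x h (h ▸ hmax)
  · exact case12 htf hQ hn x h (h ▸ hmax)
  · exact case13 htf hQ hn x h

end Core3

section Core4
variable {V : Type*} [Fintype V] [DecidableEq V] {G : SimpleGraph V} [DecidableRel G.Adj]

/-- All independent finsets have at most `k` elements. -/
def IndLe {V : Type*} (G : SimpleGraph V) (k : ℕ) : Prop :=
  ∀ I : Finset V, (∀ a ∈ I, ∀ b ∈ I, ¬ G.Adj a b) → I.card ≤ k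

lemma IndLe_comap {W : Type*} (f : W ↪ V) {k : ℕ} (h : IndLe G k) : IndLe (G.comap f) k := by
  intro I hI
  rw [← Finset.card_map f]
  apply h
  intro a ha b hb
  rw [Finset.mem_map] at ha hb
  obtain ⟨a, ha, rfl⟩ := ha
  obtain ⟨b, hb, rfl⟩ := hb
  exact hI a ha b hb

lemma cf_comap {W : Type*} (f : W ↪ V) (h : G.CliqueFree 3) : (G.comap f).CliqueFree 3 :=
  SimpleGraph.CliqueFree.comap ⟨(SimpleGraph.Embedding.comap f G).toCopy⟩ h

lemma QF_comap {W : Type*} [Fintype W] [DecidableEq W] (f : W ↪ V)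
    [DecidableRel (G.comap f).Adj] (h : QF G) : QF (G.comap f) := by
  intro u
  have ext0 : ∀ j, j ∉ Set.range f → Function.extend f u 0 j = 0 := by
    intro j hj
    rw [Function.extend_apply' _ _ _ (by simpa using hj)]; rfl
  have e : ∀ i, Function.extend f u 0 (f i) = u i := fun i => f.injective.extend_apply _ _ _
  have h1 := h (Function.extend f u 0)
  have s1 : ∑ i, Function.extend f u 0 i = ∑ i, u i :=
    (Fintype.sum_of_injective f f.injective _ _ ext0 (fun i => (e i).symm)).symm
  have s2 : ∑ i, Function.extend f u 0 i ^ 2 = ∑ i, u i ^ 2 :=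
    (Fintype.sum_of_injective f f.injective _ _ (fun j hj => by rw [ext0 j hj]; norm_num)
      (fun i => by rw [e i])).symm
  have s3 : BF G (Function.extend f u 0) (Function.extend f u 0) = BF (G.comap f) u u := by
    unfold BF
    refine (Fintype.sum_of_injective f f.injective _ _ (fun j hj => ?_) (fun i => ?_)).symm
    · rw [ext0 j hj]; simp
    · refine (Fintype.sum_of_injective f f.injective _ _ (fun j hj => ?_) (fun j => ?_))
      · rw [ext0 j hj]; simp
      · simp [e]
  rw [s1, s2, s3] at h1
  exact h1

theorem stepB (htf : G.CliqueFree 3) (hQ : QF G) (hn : 66 ≤ Fintype.card V) (x : V) :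
    G.degree x ≤ 4 := by
  by_contra hc
  have h5 : 5 ≤ (G.neighborFinset x).card := by
    rw [SimpleGraph.card_neighborFinset_eq_degree]; omega
  obtain ⟨N, hN, hN5⟩ := Finset.exists_subset_card_eq h5
  have hs : (insert x N).card ≤ 66 := by
    have := Finset.card_insert_le x N
    omega
  obtain ⟨T, hT, hT66⟩ := Finset.exists_superset_card_eq hs (by rwa [← Finset.card_univ] at hn)
  classical
  have := stepA (G := G.comap (Function.Embedding.subtype (· ∈ T)))
    (cf_comap _ htf) (QF_comap _ hQ) (by simp [hT66]) ⟨x, hT (by simp)⟩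
  have h2 : N.card ≤ (((G.comap (Function.Embedding.subtype (· ∈ T))).neighborFinset
      ⟨x, hT (by simp)⟩).map (Function.Embedding.subtype (· ∈ T))).card := by
    apply Finset.card_le_card
    intro y hy
    rw [Finset.mem_map]
    refine ⟨⟨y, hT (by simp [hy])⟩, ?_, rfl⟩
    have h3 := hN hy
    rw [SimpleGraph.mem_neighborFinset] at h3 ⊢
    exact h3
  rw [Finset.card_map, SimpleGraph.card_neighborFinset_eq_degree] at h2
  omega

end Core4

section Core6
variable {V : Type*} [Fintype V] [DecidableEq V] {G : SimpleGraph V} [DecidableRel G.Adj]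

/-- Independent finset. -/
def Ind (G : SimpleGraph V) (I : Finset V) : Prop := ∀ a ∈ I, ∀ b ∈ I, ¬ G.Adj a b

lemma EE_sdiff_left (N S T : Finset V) (h : N ⊆ S) : EE G N T + EE G (S \ N) T = EE G S T := by
  unfold EE
  rw [add_comm, Finset.sum_sdiff h]

lemma EE_mono {S S' T T' : Finset V} (h : S ⊆ S') (h' : T ⊆ T') : EE G S T ≤ EE G S' T' := by
  unfold EE
  calc _ ≤ ∑ s ∈ S, (T'.filter (G.Adj s)).card :=
        Finset.sum_le_sum fun s _ => Finset.card_le_card (Finset.filter_subset_filter _ h')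
    _ ≤ _ := Finset.sum_le_sum_of_subset h

lemma EE_sdiff_indep (N S : Finset V) (h : N ⊆ S) (h0 : EE G N N = 0) :
    EE G S S = EE G (S \ N) (S \ N) + 2 * EE G N S := by
  have h1 := EE_sdiff_left (G := G) N S S h
  have h2 := EE_sdiff_left (G := G) N S (S \ N) h
  have h3 := EE_sdiff_left (G := G) N S N h
  rw [EE_comm G S N] at h3
  rw [EE_comm G S (S \ N)] at h2
  rw [EE_comm G (S \ N) N] at h3
  omega

lemma EE_nbr_zero (htf : G.CliqueFree 3) (x : V) (N : Finset V) (h : N ⊆ G.neighborFinset x) :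
    EE G N N = 0 := by
  have := EE_mono (G := G) h h
  rw [EE_nbr_self htf] at this
  omega

lemma greedy (S : Finset V) (v : V) (hv : v ∈ S) (I : Finset V)
    (hI : I ⊆ S \ insert v (S.filter (G.Adj v))) (hi : Ind G I) :
    insert v I ⊆ S ∧ Ind G (insert v I) ∧ (insert v I).card = I.card + 1 := by
  have hS : ∀ a ∈ I, a ∈ S ∧ a ≠ v ∧ ¬ G.Adj v a := by
    intro a ha
    have := hI ha
    simp only [Finset.mem_sdiff, Finset.mem_insert, Finset.mem_filter, not_or, not_and] at this
    exact ⟨this.1, this.2.1, this.2.2 this.1⟩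
  refine ⟨?_, ?_, ?_⟩
  · intro a ha
    rcases Finset.mem_insert.1 ha with rfl | ha
    · exact hv
    · exact (hS a ha).1
  · intro a ha b hb hab
    rcases Finset.mem_insert.1 ha with h1 | h1 <;> rcases Finset.mem_insert.1 hb with h2 | h2
    · rw [h1, h2] at hab; exact G.loopless.irrefl _ hab
    · rw [h1] at hab; exact (hS b h2).2.2 hab
    · rw [h2] at hab; exact (hS a h1).2.2 hab.symm
    · exact hi a h1 b h2 hab
  · apply Finset.card_insert_of_notMem
    intro h
    exact (hS v h).2.1 rfl

lemma card_rest (S : Finset V) (v : V) (hv : v ∈ S) :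
    (S \ insert v (S.filter (G.Adj v))).card + (1 + (S.filter (G.Adj v)).card) = S.card := by
  have hsub : insert v (S.filter (G.Adj v)) ⊆ S := by
    intro a ha
    rcases Finset.mem_insert.1 ha with rfl | ha
    · exact hv
    · exact (Finset.mem_filter.1 ha).1
  have h1 := Finset.card_sdiff_add_card_eq_card hsub
  rw [Finset.card_insert_of_notMem (by simp)] at h1
  omega

lemma alpha5 (htf : G.CliqueFree 3) (S : Finset V) :
    ∃ I ⊆ S, Ind G I ∧ 6 * S.card ≤ 10 * I.card + EE G S S := by
  induction S using Finset.strongInduction with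
  | H S ih =>
    rcases S.eq_empty_or_nonempty with rfl | hne
    · exact ⟨∅, by simp, by simp [Ind], by simp⟩
    obtain ⟨v, hv, hmin⟩ := Finset.exists_min_image S
      (fun v => (S.filter (G.Adj v)).card) hne
    set N := S.filter (G.Adj v) with hN
    have hNS : N ⊆ S := Finset.filter_subset _ _
    have hss : S \ insert v N ⊂ S := by
      refine Finset.sdiff_ssubset ?_ ⟨v, by simp⟩
      exact Finset.insert_subset hv hNS
    obtain ⟨I, hI, hi, hc⟩ := ih _ hss
    obtain ⟨g1, g2, g3⟩ := greedy (G := G) S v hv I hI hi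
    refine ⟨insert v I, g1, g2, ?_⟩
    have c := card_rest (G := G) S v hv
    rw [← hN] at c
    have h0 : EE G N N = 0 := EE_nbr_zero htf v N (by intro a; simp [hN])
    have e := EE_sdiff_indep (G := G) N S hNS h0
    have m : EE G (S \ insert v N) (S \ insert v N) ≤ EE G (S \ N) (S \ N) :=
      EE_mono (Finset.sdiff_subset_sdiff le_rfl (Finset.subset_insert _ _))
        (Finset.sdiff_subset_sdiff le_rfl (Finset.subset_insert _ _))
    have q : N.card * N.card ≤ EE G N S := by
      unfold EE
      calc N.card * N.card = ∑ s ∈ N, N.card := by simp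
        _ ≤ _ := Finset.sum_le_sum fun s hs => hmin s (hNS hs)
    generalize N.card = d at *
    have : 3 * d ≤ d * d + 2 := by
      rcases Nat.lt_or_ge d 3 with h | h
      · interval_cases d <;> omega
      · nlinarith
    omega

lemma forest (S : Finset V) (h : ∀ T ⊆ S, T.Nonempty → EE G T T < 2 * T.card) :
    ∃ I ⊆ S, Ind G I ∧ S.card ≤ 2 * I.card := by
  induction S using Finset.strongInduction with
  | H S ih =>
    rcases S.eq_empty_or_nonempty with rfl | hne
    · exact ⟨∅, by simp, by simp [Ind], by simp⟩
    have h1 := h S le_rfl hne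
    have : ∃ v ∈ S, (S.filter (G.Adj v)).card < 2 := by
      by_contra hc
      push Not at hc
      unfold EE at h1
      have : ∑ s ∈ S, 2 ≤ ∑ s ∈ S, (S.filter (G.Adj s)).card := Finset.sum_le_sum hc
      simp at this
      omega
    obtain ⟨v, hv, hd⟩ := this
    have hss : S \ insert v (S.filter (G.Adj v)) ⊂ S := by
      refine Finset.sdiff_ssubset ?_ ⟨v, by simp⟩
      exact Finset.insert_subset hv (Finset.filter_subset _ _)
    obtain ⟨I, hI, hi, hc⟩ := ih _ hss (fun T hT => h T (hT.trans hss.subset))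
    obtain ⟨g1, g2, g3⟩ := greedy (G := G) S v hv I hI hi
    refine ⟨insert v I, g1, g2, ?_⟩
    have c := card_rest (G := G) S v hv
    omega

/-- Adjacency operator. -/
def av (G : SimpleGraph V) [DecidableRel G.Adj] (u : V → ℝ) (i : V) : ℝ :=
  ∑ j, if G.Adj i j then u j else 0

lemma BF_eq_av (u v : V → ℝ) : BF G u v = ∑ i, u i * av G v i := by
  unfold BF av
  refine Finset.sum_congr rfl fun i _ => ?_
  rw [Finset.mul_sum]
  refine Finset.sum_congr rfl fun j _ => ?_
  split_ifs <;> simp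

lemma av_add (u v : V → ℝ) (i : V) : av G (u + v) i = av G u i + av G v i := by
  unfold av
  rw [← Finset.sum_add_distrib]
  refine Finset.sum_congr rfl fun j _ => ?_
  split_ifs <;> simp

lemma av_ind (S : Finset V) (i : V) : av G (ind S) i = (G.neighborFinset i ∩ S).card := by
  unfold av ind
  simp only [← ite_and]
  rw [Finset.sum_boole]
  congr 2
  ext j; simp

lemma neg_key (hQ : QF G) (u : V → ℝ) (hs : 0 < ∑ i, u i) (T : Finset V)
    (hT : ∀ i, u i ≠ 0 → i ∉ T ∧ ∀ t ∈ T, ¬ G.Adj i t) :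
    (T.card / ∑ i, u i) ^ 2 * (BF G u u - 2 * ∑ i, u i ^ 2) + EE G T T ≤ 2 * T.card := by
  set s := (T.card : ℝ) / ∑ i, u i with hsd
  have h := hQ ((-s) • u + ind T)
  have e1 : ∑ i, ((-s) • u + ind T) i = 0 := by
    simp only [Pi.add_apply, Pi.smul_apply, smul_eq_mul, Finset.sum_add_distrib,
      ← Finset.mul_sum, sum_ind, hsd]
    field_simp
    ring
  have z1 : ∀ i, u i * ind T i = 0 := by
    intro i
    by_cases hu : u i = 0
    · simp [hu]
    · simp [ind, (hT i hu).1]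
  have e2 : ∑ i, (((-s) • u + ind T) i) ^ 2 = s ^ 2 * ∑ i, u i ^ 2 + T.card := by
    have : ∀ i, (((-s) • u + ind T) i) ^ 2 = s ^ 2 * u i ^ 2 + ind T i * ind T i := by
      intro i
      have := z1 i
      simp only [Pi.add_apply, Pi.smul_apply, smul_eq_mul]
      linear_combination (-2 * s) * this
    simp only [this, Finset.sum_add_distrib, ← Finset.mul_sum, sum_ind_mul, Finset.inter_self]
  have e3 : BF G u (ind T) = 0 := by
    rw [BF_eq_av]
    refine Finset.sum_eq_zero fun i _ => ?_
    by_cases hu : u i = 0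
    · simp [hu]
    · rw [av_ind]
      have : G.neighborFinset i ∩ T = ∅ := by
        ext t
        simp only [Finset.mem_inter, SimpleGraph.mem_neighborFinset, Finset.notMem_empty,
          iff_false, not_and]
        intro h1 h2
        exact (hT i hu).2 t h2 h1
      simp [this]
  rw [e1, e2] at h
  simp only [BF_add_left, BF_add_right, BF_smul_left, BF_smul_right, BF_ind,
    BF_comm G (ind T) u, e3] at h
  linarith

lemma gap (u : V → ℝ) (h0 : ∀ i, 0 ≤ u i) (h : ∀ i, 0 < u i → 2 * u i ≤ av G u i) :
    2 * ∑ i, u i ^ 2 ≤ BF G u u := by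
  rw [BF_eq_av, Finset.mul_sum]
  refine Finset.sum_le_sum fun i _ => ?_
  rcases (h0 i).lt_or_eq with hi | hi
  · have := h i hi
    nlinarith
  · rw [← hi]; simp

lemma gap_strict (u : V → ℝ) (h0 : ∀ i, 0 ≤ u i) (h : ∀ i, 0 < u i → 2 * u i ≤ av G u i)
    (z : V) (hz : 2 * u z + 1 ≤ av G u z) :
    2 * ∑ i, ((u + (1 / 2 : ℝ) • ind {z}) i) ^ 2
      < BF G (u + (1 / 2 : ℝ) • ind {z}) (u + (1 / 2 : ℝ) • ind {z}) := by
  have g := gap u h0 h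
  have e1 : BF G (ind {z}) u = av G u z := by
    rw [BF_eq_av]; simp [ind]
  have e2 : BF G (ind {z}) (ind {z}) = 0 := by
    rw [BF_ind, EE_singleton]
    have : G.neighborFinset z ∩ {z} = ∅ := by ext; simp
    simp [this]
  have e3 : ∑ i, ((u + (1 / 2 : ℝ) • ind {z}) i) ^ 2 = ∑ i, u i ^ 2 + u z + 1 / 4 := by
    have : ∀ i, ((u + (1 / 2 : ℝ) • ind {z}) i) ^ 2
        = u i ^ 2 + u i * ind {z} i + 1 / 4 * (ind {z} i * ind {z} i) := by
      intro i
      simp only [Pi.add_apply, Pi.smul_apply, smul_eq_mul]; ring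
    simp only [this, Finset.sum_add_distrib, ← Finset.mul_sum, sum_ind_mul]
    simp [ind]
  simp only [BF_add_left, BF_add_right, BF_smul_left, BF_smul_right, BF_comm G u (ind {z}),
    e1, e2]
  rw [e3]
  linarith

end Core6

section Core7
variable {V : Type*} [Fintype V] [DecidableEq V] {G : SimpleGraph V} [DecidableRel G.Adj]

/-- Closed neighbourhood. -/
def CN (G : SimpleGraph V) [DecidableRel G.Adj] (P : Finset V) : Finset V :=
  P ∪ P.biUnion fun p => G.neighborFinset p

lemma mem_CN (P : Finset V) (i : V) : i ∈ CN G P ↔ i ∈ P ∨ ∃ p ∈ P, G.Adj p i := by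
  simp [CN]

/-- Weight two on `P`, weight one on the remaining neighbours. -/
def wt (G : SimpleGraph V) [DecidableRel G.Adj] (P : Finset V) : V → ℝ := ind P + ind (CN G P)

lemma wt_nonneg (P : Finset V) (i : V) : 0 ≤ wt G P i := by
  simp only [wt, Pi.add_apply, ind]
  split_ifs <;> norm_num

lemma wt_supp (P : Finset V) (i : V) (h : wt G P i ≠ 0) : i ∈ CN G P := by
  by_contra hc
  have : i ∉ P := fun h => hc ((mem_CN P i).2 (Or.inl h))
  simp [wt, ind, hc, this] at h

lemma wt_av (P : Finset V) (i : V) :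
    av G (wt G P) i = (G.neighborFinset i ∩ P).card + (G.neighborFinset i ∩ CN G P).card := by
  rw [wt, av_add, av_ind, av_ind]

lemma wt_two (P : Finset V) (i : V) (h : i ∈ P) : wt G P i = 2 := by
  have : i ∈ CN G P := (mem_CN P i).2 (Or.inl h)
  simp [wt, ind, h, this]; norm_num

lemma wt_one (P : Finset V) (i : V) (h : i ∉ P) (h' : i ∈ CN G P) : wt G P i = 1 := by
  simp [wt, ind, h, h']

lemma wt_gap (P : Finset V) (hP : ∀ p ∈ P, 4 ≤ (G.neighborFinset p ∩ P).card + G.degree p)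
    (i : V) (hi : 0 < wt G P i) : 2 * wt G P i ≤ av G (wt G P) i := by
  have hC := wt_supp P i hi.ne'
  rw [wt_av]
  by_cases hiP : i ∈ P
  · rw [wt_two P i hiP]
    have : G.neighborFinset i ∩ CN G P = G.neighborFinset i := by
      rw [Finset.inter_eq_left]
      intro j hj
      rw [SimpleGraph.mem_neighborFinset] at hj
      exact (mem_CN P j).2 (Or.inr ⟨i, hiP, hj⟩)
    rw [this, SimpleGraph.card_neighborFinset_eq_degree]
    have := hP i hiP
    have : (4 : ℝ) ≤ (G.neighborFinset i ∩ P).card + G.degree i := by exact_mod_cast this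
    linarith
  · rw [wt_one P i hiP hC]
    rcases (mem_CN P i).1 hC with h | ⟨p, hp, hpi⟩
    · exact absurd h hiP
    have h1 : 1 ≤ (G.neighborFinset i ∩ P).card :=
      Finset.card_pos.2 ⟨p, by simp [hp, hpi.symm]⟩
    have h2 : 1 ≤ (G.neighborFinset i ∩ CN G P).card :=
      Finset.card_pos.2 ⟨p, by simp [mem_CN, hp, hpi.symm]⟩
    have h1 : (1 : ℝ) ≤ (G.neighborFinset i ∩ P).card := by exact_mod_cast h1
    have h2 : (1 : ℝ) ≤ (G.neighborFinset i ∩ CN G P).card := by exact_mod_cast h2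
    linarith

lemma wt_sum_pos (P : Finset V) (p : V) (hp : p ∈ P) : 0 < ∑ i, wt G P i := by
  refine Finset.sum_pos' (fun i _ => wt_nonneg P i) ⟨p, Finset.mem_univ p, ?_⟩
  rw [wt_two P p hp]; norm_num

lemma exists_neg (P : Finset V)
    (hP : ∀ p ∈ P, 4 ≤ (G.neighborFinset p ∩ P).card + G.degree p)
    (p q t : V) (hp : p ∈ P) (hq : q ∉ P) (hpq : G.Adj p q) (hqt : G.Adj q t) (htp : t ≠ p) :
    ∃ w : V → ℝ, 0 < ∑ i, w i ∧ 2 * ∑ i, w i ^ 2 < BF G w w ∧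
      ∀ i, w i ≠ 0 → i ∈ insert t (CN G P) := by
  have hqC : q ∈ CN G P := (mem_CN P q).2 (Or.inr ⟨p, hp, hpq⟩)
  have main : ∀ z ∈ insert t (CN G P), 2 * wt G P z + 1 ≤ av G (wt G P) z →
      ∃ w : V → ℝ, 0 < ∑ i, w i ∧ 2 * ∑ i, w i ^ 2 < BF G w w ∧
      ∀ i, w i ≠ 0 → i ∈ insert t (CN G P) := by
    intro z hz hzz
    refine ⟨_, ?_, gap_strict (wt G P) (wt_nonneg P) (wt_gap P hP) z hzz, ?_⟩
    · simp only [Pi.add_apply, Pi.smul_apply, smul_eq_mul, Finset.sum_add_distrib,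
        ← Finset.mul_sum, sum_ind]
      have := wt_sum_pos (G := G) P p hp
      simp
      linarith
    · intro i hi
      by_cases h1 : i = z
      · rwa [h1]
      · refine Finset.mem_insert_of_mem (wt_supp P i ?_)
        simpa [ind, h1] using hi
  by_cases htC : t ∈ CN G P
  · refine main q (Finset.mem_insert_of_mem hqC) ?_
    rw [wt_av, wt_one P q hq hqC]
    have h1 : 1 ≤ (G.neighborFinset q ∩ P).card :=
      Finset.card_pos.2 ⟨p, by simp [hp, hpq.symm]⟩
    have h2 : 1 < (G.neighborFinset q ∩ CN G P).card :=
      Finset.one_lt_card.2 ⟨t, by simp [hqt, htC], p, by simp [mem_CN, hp, hpq.symm], htp⟩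
    have h1 : (1 : ℝ) ≤ (G.neighborFinset q ∩ P).card := by exact_mod_cast h1
    have h2 : (2 : ℝ) ≤ (G.neighborFinset q ∩ CN G P).card := by exact_mod_cast h2
    linarith
  · refine main t (Finset.mem_insert_self _ _) ?_
    have h0 : wt G P t = 0 := by
      by_contra h
      exact htC (wt_supp P t h)
    rw [wt_av, h0]
    have h2 : 1 ≤ (G.neighborFinset t ∩ CN G P).card :=
      Finset.card_pos.2 ⟨q, by simp [hqC, hqt.symm]⟩
    have h2 : (1 : ℝ) ≤ (G.neighborFinset t ∩ CN G P).card := by exact_mod_cast h2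
    have : (0 : ℝ) ≤ (G.neighborFinset t ∩ P).card := by positivity
    linarith

lemma ind_union {U I J : Finset V} (hI : I ⊆ U) (hi : Ind G I) (hj : Ind G J)
    (hJ : ∀ j ∈ J, j ∉ CN G U) : Ind G (I ∪ J) ∧ (I ∪ J).card = I.card + J.card := by
  have hd : ∀ i ∈ I, ∀ j ∈ J, ¬ G.Adj i j ∧ i ≠ j := by
    intro i hi j hj
    have := hJ j hj
    rw [mem_CN] at this
    push Not at this
    exact ⟨this.2 i (hI hi), fun h => this.1 (h ▸ hI hi)⟩
  constructor
  · intro a ha b hb hab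
    rcases Finset.mem_union.1 ha with h1 | h1 <;> rcases Finset.mem_union.1 hb with h2 | h2
    · exact hi a h1 b h2 hab
    · exact (hd a h1 b h2).1 hab
    · exact (hd b h2 a h1).1 hab.symm
    · exact hj a h1 b h2 hab
  · apply Finset.card_union_of_disjoint
    rw [Finset.disjoint_left]
    intro a h1 h2
    exact (hd a h1 a h2).2 rfl

lemma neg_bound (hQ : QF G) (hα : IndLe G 26) (hn : Fintype.card V = 69)
    (w : V → ℝ) (hw : 0 < ∑ i, w i) (hw2 : 2 * ∑ i, w i ^ 2 < BF G w w)
    (U : Finset V) (hU : ∀ i, w i ≠ 0 → i ∈ U) (I : Finset V) (hI : I ⊆ U) (hi : Ind G I) :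
    2 * I.card + 17 ≤ (CN G U).card := by
  obtain ⟨J, hJ, hj, hc⟩ := forest (G := G) (Finset.univ \ CN G U) (by
    intro T hT hne
    have h := neg_key hQ w hw T (by
      intro i hi
      have hiU := hU i hi
      have hh : ∀ t ∈ T, t ∉ CN G U := fun t ht => (Finset.mem_sdiff.1 (hT ht)).2
      refine ⟨fun hiT => hh i hiT ((mem_CN U i).2 (Or.inl hiU)), fun t ht ha => ?_⟩
      exact hh t ht ((mem_CN U t).2 (Or.inr ⟨i, hiU, ha⟩)))
    have hT0 : (0 : ℝ) < T.card := by exact_mod_cast hne.card_pos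
    have : 0 < (T.card / ∑ i, w i) ^ 2 * (BF G w w - 2 * ∑ i, w i ^ 2) := by
      have : 0 < BF G w w - 2 * ∑ i, w i ^ 2 := by linarith
      positivity
    have : (EE G T T : ℝ) < 2 * T.card := by linarith
    exact_mod_cast this)
  obtain ⟨h1, h2⟩ := ind_union hI hi hj (fun j hjJ => (Finset.mem_sdiff.1 (hJ hjJ)).2)
  have h3 := hα _ h1
  have h4 := Finset.card_sdiff_add_card_eq_card (Finset.subset_univ (CN G U))
  rw [Finset.card_univ, hn] at h4
  omega

lemma nbr_ind (htf : G.CliqueFree 3) (x : V) : Ind G (G.neighborFinset x) := by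
  intro a ha b hb hab
  rw [SimpleGraph.mem_neighborFinset] at ha hb
  exact htf {x, a, b} (SimpleGraph.is3Clique_triple_iff.2 ⟨ha, hb, hab⟩)

lemma leafy (htf : G.CliqueFree 3) (hQ : QF G) (hα : IndLe G 26) (hn : Fintype.card V = 69)
    (D : ℕ) (hD : ∀ v, G.degree v ≤ D) (P : Finset V)
    (hP : ∀ p ∈ P, 4 ≤ (G.neighborFinset p ∩ P).card + G.degree p)
    (x : V) (hx : x ∈ P) (hx3 : 3 ≤ G.degree x)
    (hc : P.card + (CN G P \ P).card * D + D ≤ 21)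
    (p q t : V) (hp : p ∈ P) (hq : q ∉ P) (hpq : G.Adj p q) (hqt : G.Adj q t) : t = p := by
  by_contra htp
  obtain ⟨w, hw, hw2, hU⟩ := exists_neg P hP p q t hp hq hpq hqt htp
  have hqC : q ∈ CN G P := (mem_CN P q).2 (Or.inr ⟨p, hp, hpq⟩)
  have hb := neg_bound hQ hα hn w hw hw2 _ hU (G.neighborFinset x) (by
    intro y hy
    rw [SimpleGraph.mem_neighborFinset] at hy
    exact Finset.mem_insert_of_mem ((mem_CN P y).2 (Or.inr ⟨x, hx, hy⟩))) (nbr_ind htf x)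
  rw [SimpleGraph.card_neighborFinset_eq_degree] at hb
  have hsub : CN G (insert t (CN G P)) ⊆
      (P ∪ (CN G P \ P).biUnion fun q => insert q (G.neighborFinset q \ P)) ∪ G.neighborFinset t := by
    intro i hi
    have base : ∀ a ∈ CN G P, a ∈ P ∨ a ∈ CN G P \ P := by
      intro a ha
      by_cases h : a ∈ P
      · exact Or.inl h
      · exact Or.inr (Finset.mem_sdiff.2 ⟨ha, h⟩)
    have inC : ∀ a ∈ CN G P,
        a ∈ (P ∪ (CN G P \ P).biUnion fun q => insert q (G.neighborFinset q \ P)) := by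
      intro a ha
      rcases base a ha with h | h
      · exact Finset.mem_union_left _ h
      · exact Finset.mem_union_right _ (Finset.mem_biUnion.2 ⟨a, h, Finset.mem_insert_self _ _⟩)
    have inN : ∀ a ∈ CN G P, ∀ b, G.Adj a b →
        b ∈ (P ∪ (CN G P \ P).biUnion fun q => insert q (G.neighborFinset q \ P)) := by
      intro a ha b hab
      by_cases hbP : b ∈ P
      · exact Finset.mem_union_left _ hbP
      rcases base a ha with h | h
      · exact inC b ((mem_CN P b).2 (Or.inr ⟨a, h, hab⟩))
      · exact Finset.mem_union_right _ (Finset.mem_biUnion.2 ⟨a, h,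
          Finset.mem_insert_of_mem (by simp [hab, hbP])⟩)
    rcases (mem_CN _ i).1 hi with h | ⟨a, ha, hai⟩
    · rcases Finset.mem_insert.1 h with h | h
      · rw [h]; exact Finset.mem_union_left _ (inN q hqC t hqt)
      · exact Finset.mem_union_left _ (inC i h)
    · rcases Finset.mem_insert.1 ha with h | h
      · refine Finset.mem_union_right _ ?_
        rw [h] at hai
        simpa using hai
      · exact Finset.mem_union_left _ (inN a h i hai)
  have c1 := Finset.card_le_card hsub
  have c2 := Finset.card_union_le
    (P ∪ (CN G P \ P).biUnion fun q => insert q (G.neighborFinset q \ P)) (G.neighborFinset t)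
  have c3 := Finset.card_union_le P
    ((CN G P \ P).biUnion fun q => insert q (G.neighborFinset q \ P))
  have c4 : ((CN G P \ P).biUnion fun q => insert q (G.neighborFinset q \ P)).card
      ≤ (CN G P \ P).card * D := by
    apply Finset.card_biUnion_le_card_mul
    intro a ha
    rw [Finset.mem_sdiff] at ha
    rcases (mem_CN P a).1 ha.1 with h | ⟨b, hb, hba⟩
    · exact absurd h ha.2
    have d1 := Finset.card_insert_le a (G.neighborFinset a \ P)
    have d2 := Finset.card_sdiff_add_card_inter (G.neighborFinset a) P
    have d3 : 1 ≤ (G.neighborFinset a ∩ P).card :=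
      Finset.card_pos.2 ⟨b, by simp [hb, hba.symm]⟩
    rw [SimpleGraph.card_neighborFinset_eq_degree] at d2
    have := hD a
    omega
  rw [SimpleGraph.card_neighborFinset_eq_degree] at c2
  have := hD t
  omega

lemma no_deg4 (htf : G.CliqueFree 3) (hQ : QF G) (hα : IndLe G 26) (hn : Fintype.card V = 69)
    (hD : ∀ v, G.degree v ≤ 4) (x : V) : G.degree x ≤ 3 := by
  by_contra hc
  have hx : G.degree x = 4 := by have := hD x; omega
  have hP : ∀ p ∈ ({x} : Finset V), 4 ≤ (G.neighborFinset p ∩ {x}).card + G.degree p := by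
    intro p hp
    rw [Finset.mem_singleton] at hp
    rw [hp, hx]; omega
  have hCP : CN G {x} \ {x} = G.neighborFinset x := by
    ext i
    simp only [Finset.mem_sdiff, mem_CN, Finset.mem_singleton, exists_eq_left,
      SimpleGraph.mem_neighborFinset]
    constructor
    · rintro ⟨h | h, h'⟩
      · exact absurd h h'
      · exact h
    · intro h
      exact ⟨Or.inr h, h.ne'⟩
  have hl : ∀ q t, G.Adj x q → G.Adj q t → t = x := by
    intro q t hq ht
    refine leafy htf hQ hα hn 4 hD {x} hP x (by simp) (by omega) ?_ x q t (by simp)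
      (by simpa using hq.ne') hq ht
    rw [hCP, SimpleGraph.card_neighborFinset_eq_degree, hx]; simp
  have hC : (CN G {x}).card = 5 := by
    have := Finset.card_sdiff_add_card_eq_card
      (show {x} ⊆ CN G {x} by intro i hi; exact (mem_CN _ _).2 (Or.inl hi))
    rw [hCP, SimpleGraph.card_neighborFinset_eq_degree, hx] at this
    simpa using this.symm
  have hCC : CN G (CN G {x}) = CN G {x} := by
    ext i
    rw [mem_CN (CN G {x})]
    constructor
    · rintro (h | ⟨p, hp, hpi⟩)
      · exact h
      · rcases (mem_CN _ _).1 hp with h | ⟨y, hy, hyp⟩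
        · exact (mem_CN _ _).2 (Or.inr ⟨p, h, hpi⟩)
        · rw [Finset.mem_singleton] at hy
          rw [hy] at hyp
          rw [hl p i hyp hpi]
          exact (mem_CN _ _).2 (by simp)
    · exact Or.inl
  have hE := neg_key hQ (wt G {x}) (wt_sum_pos {x} x (by simp)) (Finset.univ \ CN G {x}) (by
    intro i hi
    have hiU := wt_supp {x} i hi
    have hh : ∀ t ∈ Finset.univ \ CN G {x}, t ∉ CN G (CN G {x}) := fun t ht => by
      rw [hCC]; exact (Finset.mem_sdiff.1 ht).2
    refine ⟨fun hiT => hh i hiT ((mem_CN _ i).2 (Or.inl hiU)), fun t ht ha => ?_⟩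
    exact hh t ht ((mem_CN _ t).2 (Or.inr ⟨i, hiU, ha⟩)))
  have g := gap (G := G) (wt G {x}) (wt_nonneg {x}) (wt_gap {x} hP)
  have hcard := Finset.card_sdiff_add_card_eq_card (Finset.subset_univ (CN G {x}))
  rw [Finset.card_univ, hn, hC] at hcard
  obtain ⟨J, hJ, hj, hc⟩ := alpha5 htf (Finset.univ \ CN G {x})
  set T := Finset.univ \ CN G {x} with hT
  have hE2 : (EE G T T : ℝ) ≤ 2 * T.card := by
    have : 0 ≤ (T.card / ∑ i, wt G {x} i) ^ 2
        * (BF G (wt G {x}) (wt G {x}) - 2 * ∑ i, wt G {x} i ^ 2) :=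
      mul_nonneg (sq_nonneg _) (by linarith)
    linarith
  have hE3 : EE G T T ≤ 2 * T.card := by exact_mod_cast hE2
  obtain ⟨h1, h2⟩ := ind_union (U := CN G {x}) (I := G.neighborFinset x)
    (by rw [← hCP]; exact Finset.sdiff_subset) (nbr_ind htf x) hj
    (fun j hjJ => by rw [hCC]; exact (Finset.mem_sdiff.1 (hJ hjJ)).2)
  have h3 := hα _ h1
  rw [SimpleGraph.card_neighborFinset_eq_degree, hx] at h2
  omega

end Core7

section Core8
variable {V : Type*} [Fintype V] [DecidableEq V] {G : SimpleGraph V} [DecidableRel G.Adj]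

lemma deg_one_of (q x : V) (hx : G.Adj q x) (h : ∀ t, G.Adj q t → t = x) : G.degree q = 1 := by
  rw [← SimpleGraph.card_neighborFinset_eq_degree, Finset.card_eq_one]
  refine ⟨x, ?_⟩
  ext t
  rw [SimpleGraph.mem_neighborFinset, Finset.mem_singleton]
  exact ⟨h t, fun h => h ▸ hx⟩

lemma one_unique (q a b : V) (h : G.degree q = 1) (ha : G.Adj q a) (hb : G.Adj q b) : a = b := by
  rw [← SimpleGraph.card_neighborFinset_eq_degree] at h
  exact Finset.card_le_one.1 h.le a (by simpa using ha) b (by simpa using hb)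

lemma card_erase_nbr (x y : V) (h : G.Adj x y) :
    ((G.neighborFinset x).erase y).card + 1 = G.degree x := by
  rw [Finset.card_erase_add_one (by simpa using h), SimpleGraph.card_neighborFinset_eq_degree]

lemma pair_leaf (htf : G.CliqueFree 3) (hQ : QF G) (hα : IndLe G 26) (hn : Fintype.card V = 69)
    (hD : ∀ v, G.degree v ≤ 3) (x y : V) (hx : G.degree x = 3) (hy : G.degree y = 3)
    (hxy : G.Adj x y) (q : V) (hq : G.Adj x q) (hqy : q ≠ y) : G.degree q = 1 := by
  refine deg_one_of q x hq.symm fun t ht => ?_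
  refine leafy htf hQ hα hn 3 hD {x, y} ?_ x (by simp) (by omega) ?_ x q t (by simp) ?_ hq ht
  · intro p hp
    have h1 : 1 ≤ (G.neighborFinset p ∩ {x, y}).card := by
      rw [Finset.mem_insert, Finset.mem_singleton] at hp
      rcases hp with rfl | rfl
      · exact Finset.card_pos.2 ⟨y, by simp [hxy]⟩
      · exact Finset.card_pos.2 ⟨x, by simp [hxy.symm]⟩
    have h2 : G.degree p = 3 := by
      rw [Finset.mem_insert, Finset.mem_singleton] at hp
      rcases hp with rfl | rfl <;> assumption
    omega
  · have hsub : CN G {x, y} \ {x, y} ⊆ (G.neighborFinset x).erase y ∪ (G.neighborFinset y).erase x := by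
      intro i hi
      simp only [Finset.mem_sdiff, mem_CN, Finset.mem_insert, Finset.mem_singleton, not_or,
        exists_eq_or_imp, exists_eq_left] at hi
      simp only [Finset.mem_union, Finset.mem_erase, SimpleGraph.mem_neighborFinset]
      tauto
    have c1 := Finset.card_le_card hsub
    have c2 := Finset.card_union_le ((G.neighborFinset x).erase y) ((G.neighborFinset y).erase x)
    have c3 := card_erase_nbr x y hxy
    have c4 := card_erase_nbr y x hxy.symm
    have c5 := Finset.card_le_two (a := x) (b := y)
    omega
  · simp [hq.ne', hqy]

lemma path_leaf (htf : G.CliqueFree 3) (hQ : QF G) (hα : IndLe G 26) (hn : Fintype.card V = 69)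
    (hD : ∀ v, G.degree v ≤ 3) (x y z : V) (hx : G.degree x = 3) (hy : G.degree y = 3)
    (hne : x ≠ y) (hxz : G.Adj x z) (hyz : G.Adj y z) (q : V) (hq : G.Adj x q) (hqz : q ≠ z) :
    G.degree q = 1 := by
  have hxy : ¬ G.Adj x y := fun h =>
    htf {x, y, z} (SimpleGraph.is3Clique_triple_iff.2 ⟨h, hxz, hyz⟩)
  have hz2 : 2 ≤ (G.neighborFinset z ∩ {x, z, y}).card :=
    Finset.one_lt_card.2 ⟨x, by simp [hxz.symm], y, by simp [hyz.symm], hne⟩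
  have hzd : 2 ≤ G.degree z := by
    rw [← SimpleGraph.card_neighborFinset_eq_degree]
    exact hz2.trans (Finset.card_le_card Finset.inter_subset_left)
  refine deg_one_of q x hq.symm fun t ht => ?_
  refine leafy htf hQ hα hn 3 hD {x, z, y} ?_ x (by simp) (by omega) ?_ x q t (by simp) ?_ hq ht
  · intro p hp
    simp only [Finset.mem_insert, Finset.mem_singleton] at hp
    rcases hp with rfl | rfl | rfl
    · have : 1 ≤ (G.neighborFinset p ∩ {p, z, y}).card :=
        Finset.card_pos.2 ⟨z, by simp [hxz]⟩
      omega
    · omega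
    · have : 1 ≤ (G.neighborFinset p ∩ {x, z, p}).card :=
        Finset.card_pos.2 ⟨z, by simp [hyz]⟩
      omega
  · have hsub : CN G {x, z, y} \ {x, z, y} ⊆ ((G.neighborFinset x).erase z ∪
        (G.neighborFinset y).erase z) ∪ ((G.neighborFinset z).erase x).erase y := by
      intro i hi
      simp only [Finset.mem_sdiff, mem_CN, Finset.mem_insert, Finset.mem_singleton, not_or,
        exists_eq_or_imp, exists_eq_left] at hi
      simp only [Finset.mem_union, Finset.mem_erase, SimpleGraph.mem_neighborFinset]
      tauto
    have c1 := Finset.card_le_card hsub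
    have c2 := Finset.card_union_le ((G.neighborFinset x).erase z ∪
        (G.neighborFinset y).erase z) (((G.neighborFinset z).erase x).erase y)
    have c2b := Finset.card_union_le ((G.neighborFinset x).erase z) ((G.neighborFinset y).erase z)
    have c3 := card_erase_nbr x z hxz
    have c4 := card_erase_nbr y z hyz
    have c6 := card_erase_nbr z x hxz.symm
    have c7 := Finset.card_erase_add_one (s := (G.neighborFinset z).erase x) (a := y)
      (by simp [hyz.symm, hne.symm])
    have c5 := Finset.card_le_three (a := x) (b := z) (c := y)
    have := hD z
    omega
  · have : q ≠ y := fun h => hxy (h ▸ hq)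
    simp [hq.ne', hqz, this]

/-- degree-three vertices close to another degree-three vertex. -/
def Bad (G : SimpleGraph V) [DecidableRel G.Adj] (x : V) : Prop :=
  ∃ y, y ≠ x ∧ G.degree y = 3 ∧ (G.Adj x y ∨ ∃ z, G.Adj x z ∧ G.Adj y z)

lemma bad_leaves (htf : G.CliqueFree 3) (hQ : QF G) (hα : IndLe G 26) (hn : Fintype.card V = 69)
    (hD : ∀ v, G.degree v ≤ 3) (x : V) (hx : G.degree x = 3) (hb : Bad G x) :
    2 ≤ ((G.neighborFinset x).filter fun q => G.degree q = 1).card := by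
  have : ∃ y, G.Adj x y ∧ ∀ q, G.Adj x q → q ≠ y → G.degree q = 1 := by
    obtain ⟨y, hne, hy, h | ⟨z, hxz, hyz⟩⟩ := hb
    · exact ⟨y, h, pair_leaf htf hQ hα hn hD x y hx hy h⟩
    · exact ⟨z, hxz, path_leaf htf hQ hα hn hD x y z hx hy hne.symm hxz hyz⟩
  obtain ⟨y, hxy, h⟩ := this
  have c := card_erase_nbr x y hxy
  have : (G.neighborFinset x).erase y ⊆ (G.neighborFinset x).filter fun q => G.degree q = 1 := by
    intro q hq
    rw [Finset.mem_erase, SimpleGraph.mem_neighborFinset] at hq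
    rw [Finset.mem_filter, SimpleGraph.mem_neighborFinset]
    exact ⟨hq.2, h q hq.2 hq.1⟩
  have := Finset.card_le_card this
  omega

lemma sum_deg_le (hD : ∀ v, G.degree v ≤ 3) (hn : Fintype.card V = 69) :
    S1 G + (Finset.univ.filter fun v => G.degree v = 1).card
      ≤ 138 + (Finset.univ.filter fun v => G.degree v = 3).card := by
  rw [S1, EE_univ, Finset.card_filter, Finset.card_filter, ← Finset.sum_add_distrib]
  have : (138 : ℕ) = ∑ v : V, 2 := by simp [hn]
  rw [this, ← Finset.sum_add_distrib]
  refine Finset.sum_le_sum fun v _ => ?_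
  have := hD v
  generalize G.degree v = d at *
  interval_cases d <;> simp

lemma S1_upper (htf : G.CliqueFree 3) (hQ : QF G) (hα : IndLe G 26) (hn : Fintype.card V = 69)
    (hD : ∀ v, G.degree v ≤ 3) : S1 G ≤ 155 := by
  classical
  have h0 := sum_deg_le hD hn
  have hsplit : ((Finset.univ.filter fun v => G.degree v = 3).filter (Bad G)).card +
      ((Finset.univ.filter fun v => G.degree v = 3).filter (fun v => ¬ Bad G v)).card
      = (Finset.univ.filter fun v => G.degree v = 3).card :=
    Finset.card_filter_add_card_filter_not _
  set B := (Finset.univ.filter fun v => G.degree v = 3).filter (Bad G) with hB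
  set A := (Finset.univ.filter fun v => G.degree v = 3).filter (fun v => ¬ Bad G v) with hA
  have hb : B.card * 2 ≤ (Finset.univ.filter fun v => G.degree v = 1).card := by
    calc B.card * 2 = ∑ x ∈ B, 2 := by simp
      _ ≤ ∑ x ∈ B, ((G.neighborFinset x).filter fun q => G.degree q = 1).card := by
        refine Finset.sum_le_sum fun x hx => ?_
        simp only [hB, Finset.mem_filter, Finset.mem_univ, true_and] at hx
        exact bad_leaves htf hQ hα hn hD x hx.1 hx.2
      _ = (B.biUnion fun x => (G.neighborFinset x).filter fun q => G.degree q = 1).card := by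
        rw [Finset.card_biUnion]
        intro x _ y _ hxy
        rw [Function.onFun, Finset.disjoint_left]
        intro q h1 h2
        rw [Finset.mem_filter, SimpleGraph.mem_neighborFinset] at h1 h2
        exact hxy (one_unique q x y h1.2 h1.1.symm h2.1.symm)
      _ ≤ _ := by
        apply Finset.card_le_card
        intro q hq
        simp only [Finset.mem_biUnion, Finset.mem_filter] at hq
        obtain ⟨x, -, -, h⟩ := hq
        simp [h]
  have ha : A.card * 4 ≤ 69 := by
    calc A.card * 4 = ∑ x ∈ A, 4 := by simp
      _ = ∑ x ∈ A, (insert x (G.neighborFinset x)).card := by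
        refine Finset.sum_congr rfl fun x hx => ?_
        simp only [hA, Finset.mem_filter, Finset.mem_univ, true_and] at hx
        rw [Finset.card_insert_of_notMem (by simp), SimpleGraph.card_neighborFinset_eq_degree, hx.1]
      _ = (A.biUnion fun x => insert x (G.neighborFinset x)).card := by
        rw [Finset.card_biUnion]
        intro x hx y hy hxy
        simp only [hA, Finset.coe_filter, Finset.mem_filter, Finset.mem_univ, true_and,
          Set.mem_ofPred_eq] at hx hy
        rw [Function.onFun, Finset.disjoint_left]
        intro q h1 h2
        simp only [Finset.mem_insert, SimpleGraph.mem_neighborFinset] at h1 h2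
        apply hx.2
        refine ⟨y, hxy.symm, hy.1, ?_⟩
        rcases h1 with h1 | h1 <;> rcases h2 with h2 | h2
        · exact absurd (h1.symm.trans h2) hxy
        · rw [h1] at h2; exact Or.inl h2.symm
        · rw [h2] at h1; exact Or.inl h1
        · exact Or.inr ⟨q, h1, h2⟩
      _ ≤ (Finset.univ : Finset V).card := Finset.card_le_card (Finset.subset_univ _)
      _ = 69 := by rw [Finset.card_univ, hn]
  omega

lemma S1_lower (htf : G.CliqueFree 3) (hα : IndLe G 26) (hn : Fintype.card V = 69) :
    154 ≤ S1 G := by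
  obtain ⟨I, -, hi, hc⟩ := alpha5 htf (Finset.univ : Finset V)
  have := hα I hi
  rw [Finset.card_univ, hn] at hc
  unfold S1
  omega

lemma S1_lower2 (htf : G.CliqueFree 3) (hα : IndLe G 26) (hn : Fintype.card V = 69) (y : V)
    (hy : G.degree y = 2) (h5 : 5 ≤ sn G y) : 156 ≤ S1 G := by
  have hf : (Finset.univ.filter (G.Adj y)) = G.neighborFinset y := by ext; simp
  obtain ⟨I, hI, hi, hc⟩ := alpha5 htf (Finset.univ \ insert y (Finset.univ.filter (G.Adj y)))
  obtain ⟨g1, g2, g3⟩ := greedy (G := G) Finset.univ y (Finset.mem_univ y) I hI hi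
  have h := hα _ g2
  have c := card_rest (G := G) Finset.univ y (Finset.mem_univ y)
  rw [hf] at c hc
  rw [Finset.card_univ, hn, SimpleGraph.card_neighborFinset_eq_degree, hy] at c
  have e := EE_sdiff_indep (G := G) (G.neighborFinset y) Finset.univ (Finset.subset_univ _)
    (EE_nbr_self htf y)
  have m : EE G (Finset.univ \ insert y (G.neighborFinset y))
      (Finset.univ \ insert y (G.neighborFinset y))
      ≤ EE G (Finset.univ \ G.neighborFinset y) (Finset.univ \ G.neighborFinset y) :=
      EE_mono (Finset.sdiff_subset_sdiff le_rfl (Finset.subset_insert _ _))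
        (Finset.sdiff_subset_sdiff le_rfl (Finset.subset_insert _ _))
  unfold S1
  unfold sn at h5
  omega

theorem stepC (htf : G.CliqueFree 3) (hQ : QF G) (hα : IndLe G 26) (hn : Fintype.card V = 69)
    (hD4 : ∀ v, G.degree v ≤ 4) : False := by
  classical
  have hD := no_deg4 htf hQ hα hn hD4
  have hup := S1_upper htf hQ hα hn hD
  have hlo := S1_lower htf hα hn
  have hs := sum_deg_le hD hn
  have hleaf : ∀ v, ∃ l, G.degree v = 3 → G.degree l = 1 ∧
      (G.Adj v l ∨ ∃ y, G.degree y = 2 ∧ G.Adj v y ∧ G.Adj y l) := by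
    intro v
    by_cases hv : G.degree v = 3
    swap
    · exact ⟨v, fun h => absurd h hv⟩
    by_cases h1 : ∃ l, G.Adj v l ∧ G.degree l = 1
    · obtain ⟨l, h2, h3⟩ := h1
      exact ⟨l, fun _ => ⟨h3, Or.inl h2⟩⟩
    push Not at h1
    have hnb : ¬ Bad G v := by
      intro hb
      have := bad_leaves htf hQ hα hn hD v hv hb
      obtain ⟨l, hl⟩ := Finset.card_pos.1 (by omega : 0 < ((G.neighborFinset v).filter
        fun q => G.degree q = 1).card)
      rw [Finset.mem_filter, SimpleGraph.mem_neighborFinset] at hl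
      exact h1 l hl.1 hl.2
    obtain ⟨y, hvy⟩ := (SimpleGraph.degree_pos_iff_exists_adj (G := G) v).1 (by omega)
    have hy3 : G.degree y ≠ 3 := fun h => hnb ⟨y, hvy.ne', h, Or.inl hvy⟩
    have hy0 : 0 < G.degree y := (SimpleGraph.degree_pos_iff_exists_adj (G := G) y).2 ⟨v, hvy.symm⟩
    have hy1 := h1 y hvy
    have hy2 : G.degree y = 2 := by have := hD y; omega
    have he := card_erase_nbr y v hvy.symm
    obtain ⟨w, hw⟩ := Finset.card_eq_one.1 (by omega : ((G.neighborFinset y).erase v).card = 1)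
    have hwm : w ∈ (G.neighborFinset y).erase v := by rw [hw]; simp
    rw [Finset.mem_erase, SimpleGraph.mem_neighborFinset] at hwm
    have hsn : sn G y = G.degree v + G.degree w := by
      rw [sn, EE_univ, ← Finset.add_sum_erase _ _ (by simpa using hvy.symm :
        v ∈ G.neighborFinset y), hw, Finset.sum_singleton]
    have hw0 : 0 < G.degree w := (SimpleGraph.degree_pos_iff_exists_adj (G := G) w).2
      ⟨y, hwm.2.symm⟩
    refine ⟨w, fun _ => ⟨?_, Or.inr ⟨y, hy2, hvy, hwm.2⟩⟩⟩
    by_contra hw1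
    have := S1_lower2 htf hα hn y hy2 (by omega)
    omega
  choose f hf using hleaf
  have hcard : (Finset.univ.filter fun v => G.degree v = 3).card
      ≤ (Finset.univ.filter fun v => G.degree v = 1).card := by
    refine Finset.card_le_card_of_injOn f ?_ ?_
    · intro v hv
      simp only [Finset.coe_filter, Finset.mem_univ, true_and, Set.mem_ofPred_eq] at hv ⊢
      exact (hf v hv).1
    · intro v hv v' hv' hvv
      simp only [Finset.coe_filter, Finset.mem_univ, true_and, Set.mem_ofPred_eq] at hv hv'
      obtain ⟨l1, h⟩ := hf v hv
      obtain ⟨-, h'⟩ := hf v' hv'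
      rw [← hvv] at h'
      rcases h with h | ⟨y, hy, hvy, hyl⟩ <;> rcases h' with h' | ⟨y', hy', hvy', hyl'⟩
      · exact one_unique _ _ _ l1 h.symm h'.symm
      · have := one_unique _ _ _ l1 h.symm hyl'.symm
        rw [this] at hv; omega
      · have := one_unique _ _ _ l1 hyl.symm h'.symm
        rw [← this] at hv'; omega
      · have e := one_unique _ _ _ l1 hyl.symm hyl'.symm
        rw [← e] at hvy'
        have c := card_erase_nbr y (f v) hyl
        refine Finset.card_le_one.1 (by omega : ((G.neighborFinset y).erase (f v)).card ≤ 1) v ?_ v' ?_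
        · rw [Finset.mem_erase, SimpleGraph.mem_neighborFinset]
          refine ⟨fun h => ?_, hvy.symm⟩
          rw [← h] at l1; omega
        · rw [Finset.mem_erase, SimpleGraph.mem_neighborFinset]
          refine ⟨fun h => ?_, hvy'.symm⟩
          rw [← h] at l1; omega
  omega

theorem stepC' (htf : G.CliqueFree 3) (hQ : QF G) (hα : IndLe G 26) :
    Fintype.card V ≤ 68 := by
  classical
  by_contra hc
  push Not at hc
  obtain ⟨T, -, hT⟩ := Finset.exists_subset_card_eq
    (by rw [Finset.card_univ]; exact hc : 69 ≤ (Finset.univ : Finset V).card)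
  have hcard : Fintype.card {v // v ∈ T} = 69 := by simp [hT]
  have a1 := cf_comap (G := G) (Function.Embedding.subtype (· ∈ T)) htf
  have a2 := QF_comap (G := G) (Function.Embedding.subtype (· ∈ T)) hQ
  exact stepC a1 a2 (IndLe_comap _ hα) hcard (stepB a1 a2 (by omega))

end Core8

lemma quad_of_minEig {W : Type*} [Fintype W] [DecidableEq W] (A : Matrix W W ℝ)
    (hA : A.IsHermitian) (c : ℝ) (h : c ≤ minEig A) (y : W → ℝ) :
    c * ∑ i, y i ^ 2 ≤ ∑ i, ∑ j, A i j * (y i * y j) := by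
  classical
  unfold minEig at h
  rw [dif_pos hA] at h
  have he : ∀ i, c ≤ hA.eigenvalues i := fun i =>
    h.trans (ciInf_le (Set.finite_range _).bddBelow i)
  have hsub : (A - c • (1 : Matrix W W ℝ)).IsHermitian := by
    refine hA.sub ?_
    simp [Matrix.IsHermitian]
  have hps : (A - c • (1 : Matrix W W ℝ)).PosSemidef := by
    rw [hsub.posSemidef_iff_eigenvalues_nonneg]
    intro i
    have := hsub.eigenvalues_mem_spectrum_real i
    have h2 : hsub.eigenvalues i + c ∈ spectrum ℝ A := by
      rw [spectrum.add_mem_iff]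
      convert this using 2
      rw [Algebra.algebraMap_eq_smul_one]
      abel
    rw [hA.spectrum_real_eq_range_eigenvalues] at h2
    obtain ⟨j, hj⟩ := h2
    have := he j
    simp only [Pi.zero_apply]
    linarith
  have := hps.dotProduct_mulVec_nonneg y
  rw [Matrix.sub_mulVec, Matrix.smul_mulVec, Matrix.one_mulVec, dotProduct_sub,
    dotProduct_smul] at this
  simp only [star_trivial, smul_eq_mul, dotProduct, mulVec, Finset.mul_sum] at this
  rw [Finset.mul_sum]
  have e1 : ∀ i j, A i j * (y i * y j) = y i * (A i j * y j) := fun i j => by ring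
  simp only [e1, pow_two]
  linarith

lemma quad_seidel {W : Type*} [Fintype W] [DecidableEq W] (H : SimpleGraph W)
    [DecidableRel H.Adj] (h : -5 ≤ minSeidelEig H) (y : W → ℝ) :
    2 * BF H y y ≤ 4 * ∑ i, y i ^ 2 + (∑ i, y i) ^ 2 := by
  classical
  have e : Fintype.ofFinite W = ‹Fintype W› := Subsingleton.elim _ _
  unfold minSeidelEig at h
  rw [e] at h
  have hH : (seidelOf H).IsHermitian := by
    ext i j
    by_cases h1 : i = j
    · subst h1; simp
    · by_cases h2 : H.Adj i j
      · simp [seidelOf, h1, h2, Ne.symm h1, h2.symm]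
      · have h3 : ¬ H.Adj j i := fun h => h2 h.symm
        simp [seidelOf, h1, h2, Ne.symm h1, h3]
  have q := quad_of_minEig (seidelOf H) hH (-5) (by convert h) y
  have e2 : ∑ i, ∑ j, seidelOf H i j * (y i * y j)
      = (∑ i, y i) ^ 2 - ∑ i, y i ^ 2 - 2 * BF H y y := by
    have : ∀ i j, seidelOf H i j * (y i * y j) = y i * y j - (if i = j then y i * y j else 0)
        - 2 * (if H.Adj i j then y i * y j else 0) := by
      intro i j
      by_cases hij : i = j
      · subst hij; simp [seidelOf]
      · by_cases ha : H.Adj i j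
        · simp [seidelOf, hij, ha]; ring
        · simp [seidelOf, hij, ha]
    simp only [this, Finset.sum_sub_distrib, ← Finset.mul_sum, BF]
    simp [pow_two, Finset.sum_mul_sum, Finset.mul_sum, Finset.sum_mul]
    rw [Finset.sum_comm]
  rw [e2] at q
  linarith

lemma QF_of_min {V : Type*} [Fintype V] [DecidableEq V] (G : SimpleGraph V) [DecidableRel G.Adj]
    (h : -5 ≤ minSeidelEig (G ⊕g nK2 2)) : QF G := by
  classical
  intro v
  set c : ℝ := -(∑ i, v i) / 6 with hc
  have q := quad_seidel (G ⊕g nK2 2) h (Sum.elim v (fun _ => c))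
  have e : BF (G ⊕g nK2 2) (Sum.elim v (fun _ => c)) (Sum.elim v (fun _ => c))
      = BF G v v + 4 * c ^ 2 := by
    unfold BF
    simp [Fintype.sum_sum_type, Fintype.sum_prod_type, nK2]
    ring_nf
  rw [e] at q
  simp [Fintype.sum_sum_type, Fintype.sum_prod_type] at q
  have hs : ∑ i, v i = -6 * c := by rw [hc]; ring
  rw [hs] at q ⊢
  linarith

lemma IndLe_of_indepNum {V : Type*} [Fintype V] (G : SimpleGraph V) (k : ℕ)
    (h : indepNum G ≤ k) : IndLe G k := by
  intro I hI
  refine le_trans ?_ h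
  apply SimpleGraph.IsClique.card_le_cliqueNum
  intro a ha b hb hab
  exact (SimpleGraph.compl_adj _ _ _).2 ⟨hab, hI a ha b hb⟩

/-- Let `G` be a triangle-free graph of order `m` with
`λ_min(S(G ∪ 2K₂)) ≥ -5` and independence number `α(G) ≤ 26`. Then `m ≤ 68`, and if
`m ≥ 66` there is an edge `xy` of `G` with `deg x + deg y ≤ 20`. -/
theorem stmt_17 {m : ℕ} (G : SimpleGraph (Fin m)) (htf : G.CliqueFree 3)
    (hmin : -5 ≤ minSeidelEig (G ⊕g nK2 2))
    (hα : indepNum G ≤ 26) :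
    m ≤ 68 ∧
      (66 ≤ m → ∃ x y, G.Adj x y ∧
        (G.neighborSet x).ncard + (G.neighborSet y).ncard ≤ 20) := by
  classical
  have hQ := QF_of_min G hmin
  have hI := IndLe_of_indepNum G 26 hα
  refine ⟨?_, ?_⟩
  · have := stepC' htf hQ hI
    simpa using this
  · intro hm
    have hD := stepB htf hQ (by simpa using hm)
    have hdeg : ∀ x, (G.neighborSet x).ncard ≤ 4 := by
      intro x
      have h4 := hD x
      rwa [← SimpleGraph.card_neighborFinset_eq_degree, ← Set.ncard_coe_finset,
        SimpleGraph.coe_neighborFinset] at h4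
    by_contra hc
    push Not at hc
    have h1 := hI Finset.univ (by
      intro a _ b _ hab
      have := hc a b hab
      have := hdeg a
      have := hdeg b
      omega)
    rw [Finset.card_univ, Fintype.card_fin] at h1
    omega
end

section
/- Let G be a triangle-free simple graph of order n_G ≥ 66 such that the Seidel matrix of the disjoint union G ∪ 2K_2 has smallest eigenvalue at least −5. Then (i) the maximum degree of G is at most 12; and (ii) G does not contain the complete bipartite graph K_{2,3} as an induced subgraph. -/
open Matrix

theorem seidel_quad {V : Type*} [Fintype V] [DecidableEq V] (G : SimpleGraph V)
    [DecidableRel G.Adj] (h : -5 ≤ minSeidelEig G) (y : V → ℝ) :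
    0 ≤ ∑ i, ∑ j, y i * y j * (if i = j then 5 else if G.Adj i j then -1 else 1) := by
  classical
  have hS : (seidelOf G).IsHermitian := by
    ext i j
    simp only [seidelOf, Matrix.conjTranspose_apply, Matrix.of_apply, eq_comm (a := i), G.adj_comm i,
      star_trivial]
    congr
  have h' : -5 ≤ minEig (seidelOf G) := by
    unfold minSeidelEig at h
    convert h
  unfold minEig at h'
  have h2 : -5 ≤ ⨅ i, hS.eigenvalues i := by
    simp only [hS, dif_pos] at h'
    convert h'
  have h3 : ∀ i, -5 ≤ hS.eigenvalues i := fun i =>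
    h2.trans (ciInf_le (Set.finite_range _).bddBelow i)
  set M : Matrix V V ℝ := algebraMap ℝ (Matrix V V ℝ) 5 + seidelOf G with hM
  have hMh : M.IsHermitian := by
    refine Matrix.IsHermitian.add ?_ hS
    rw [Matrix.algebraMap_eq_diagonal]
    exact Matrix.isHermitian_diagonal _
  have hP : M.PosSemidef := by
    rw [hMh.posSemidef_iff_eigenvalues_nonneg]
    intro i
    have hi := hMh.eigenvalues_mem_spectrum_real i
    simp only [Pi.zero_apply]
    generalize hMh.eigenvalues i = t at hi ⊢
    have e : t = (t - 5) + 5 := by ring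
    rw [e, hM, spectrum.add_mem_add_iff, hS.spectrum_real_eq_range_eigenvalues] at hi
    obtain ⟨j, hj⟩ := hi
    have := h3 j
    rw [hj] at this
    linarith
  have := hP.dotProduct_mulVec_nonneg y
  simp only [dotProduct, mulVec, Finset.mul_sum] at this
  refine this.trans_eq (Finset.sum_congr rfl fun i _ => Finset.sum_congr rfl fun j _ => ?_)
  by_cases hij : i = j
  · subst hij
    simp [hM, seidelOf, Matrix.algebraMap_eq_diagonal]; ring
  · simp [hM, seidelOf, Matrix.algebraMap_eq_diagonal, hij]

/-- The reduced matrix `J + 12 I - 6 A`. -/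
noncomputable def redMat {m : ℕ} (G : SimpleGraph (Fin m)) : Matrix (Fin m) (Fin m) ℝ := by
  classical
  exact Matrix.of fun i j => if i = j then 13 else if G.Adj i j then -5 else 1

theorem redMat_self {m : ℕ} (G : SimpleGraph (Fin m)) (i) : redMat G i i = 13 := by
  simp [redMat]
theorem redMat_adj {m : ℕ} (G : SimpleGraph (Fin m)) {i j} (h : G.Adj i j) :
    redMat G i j = -5 := by
  simp [redMat, h, h.ne]
theorem redMat_nadj {m : ℕ} (G : SimpleGraph (Fin m)) {i j} (hne : i ≠ j) (h : ¬ G.Adj i j) :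
    redMat G i j = 1 := by
  simp [redMat, h, hne]

theorem redMat_psd {m : ℕ} (G : SimpleGraph (Fin m))
    (hmin : -5 ≤ minSeidelEig (G ⊕g nK2 2)) : (redMat G).PosSemidef := by
  classical
  refine .of_dotProduct_mulVec_nonneg ?_ fun x => ?_
  · ext i j
    simp only [redMat, Matrix.conjTranspose_apply, Matrix.of_apply, eq_comm (a := i), G.adj_comm i,
      star_trivial]
  have h := seidel_quad _ hmin (Sum.elim x (fun _ => -(∑ i, x i) / 6))
  set s := ∑ i, x i with hs
  have e1 : ∑ i, ∑ j, x i * x j * (if i = j then 5 else if G.Adj i j then -1 else 1)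
      = (star x ⬝ᵥ (redMat G *ᵥ x) + 2 * s ^ 2) / 3 := by
    rw [hs, sq, Finset.sum_mul_sum]
    simp only [dotProduct, mulVec, Finset.mul_sum, ← Finset.sum_add_distrib, Finset.sum_div]
    refine Finset.sum_congr rfl fun i _ => Finset.sum_congr rfl fun j _ => ?_
    simp only [redMat, Matrix.of_apply, Pi.star_apply, star_trivial]
    split_ifs <;> ring
  simp only [mul_ite, mul_neg, mul_one] at e1
  have e2 : ∑ i, x i * (-s / 6) * 1 = s * (-s / 6) := by
    rw [hs, Finset.sum_mul]; simp
  simp [Fintype.sum_sum_type, Fintype.sum_prod_type, Fin.sum_univ_two, nK2,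
    Finset.sum_add_distrib] at h
  rw [e1] at h
  simp only [← Finset.mul_sum, ← Finset.sum_mul, ← hs] at h
  nlinarith [h]

theorem redMat_quad {m : ℕ} {G : SimpleGraph (Fin m)} (hP : (redMat G).PosSemidef)
    {ι : Type*} [Fintype ι] (f : ι → Fin m) (x : ι → ℝ) :
    0 ≤ ∑ i, ∑ j, x i * x j * redMat G (f i) (f j) := by
  have := (hP.submatrix f).dotProduct_mulVec_nonneg x
  simp only [dotProduct, mulVec, Finset.mul_sum] at this
  refine this.trans_eq (Finset.sum_congr rfl fun i _ => Finset.sum_congr rfl fun j _ => ?_)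
  simp only [Pi.star_apply, star_trivial, Matrix.submatrix_apply]
  ring

theorem no_tri {m : ℕ} {G : SimpleGraph (Fin m)} (htf : G.CliqueFree 3) {a b c : Fin m}
    (h1 : G.Adj a b) (h2 : G.Adj a c) : ¬ G.Adj b c := by
  intro h3
  exact htf {a, b, c} (SimpleGraph.is3Clique_triple_iff.2 ⟨h1, h2, h3⟩)

theorem deg_le_13 {m : ℕ} {G : SimpleGraph (Fin m)} [DecidableRel G.Adj]
    (hP : (redMat G).PosSemidef) (htf : G.CliqueFree 3) (v : Fin m) : G.degree v ≤ 13 := by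
  by_contra! hd
  obtain ⟨D, hD, hc⟩ := Finset.exists_subset_card_eq (s := G.neighborFinset v) (n := 14) hd
  have e : Fin 14 ≃ D := (Finset.equivFinOfCardEq hc).symm
  have hadj : ∀ i, G.Adj v (e i) := fun i => by simpa using hD (e i).2
  have h1 : ∀ i, redMat G v (e i) = -5 := fun i => redMat_adj G (hadj i)
  have h2 : ∀ i, redMat G (e i) v = -5 := fun i => redMat_adj G (hadj i).symm
  have h3 : ∀ i j, redMat G (e i) (e j) = if i = j then 13 else 1 := fun i j => by
    split_ifs with h
    · rw [h, redMat_self]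
    · exact redMat_nadj G (fun h' => h (e.injective (Subtype.ext h')))
        (no_tri htf (hadj i) (hadj j))
  have := redMat_quad hP (Sum.elim (fun _ : Unit => v) (fun i => (e i : Fin m)))
    (Sum.elim (fun _ => 5) (fun _ => 1))
  simp [Fintype.sum_sum_type, h1, h2, h3, redMat_self, Finset.sum_ite, Finset.filter_eq,
    Finset.filter_ne] at this
  norm_num at this

theorem three_common {m : ℕ} {G : SimpleGraph (Fin m)} [DecidableRel G.Adj]
    (hP : (redMat G).PosSemidef) (htf : G.CliqueFree 3) {v : Fin m} (hv : G.degree v = 13)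
    {w : Fin m} (hne : w ≠ v) (hw : ¬ G.Adj w v) :
    (G.neighborFinset v ∩ G.neighborFinset w).card = 3 := by
  classical
  set x : Fin m → ℝ := fun j => (if j = v then 5 else 0) + (if j ∈ G.neighborFinset v then 1 else 0)
    with hx
  have hmul : ∀ i, (redMat G *ᵥ x) i
      = 5 * redMat G i v + ∑ j ∈ G.neighborFinset v, redMat G i j := by
    intro i
    simp only [mulVec, dotProduct, hx, mul_add, Finset.sum_add_distrib, mul_ite, mul_zero, mul_one,
      Finset.sum_ite_eq', Finset.mem_univ, if_true, Finset.sum_ite_mem, Finset.univ_inter]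
    ring
  have hcard : (G.neighborFinset v).card = 13 := hv
  have hsv : (redMat G *ᵥ x) v = 0 := by
    rw [hmul, redMat_self, Finset.sum_congr rfl (g := fun _ => (-5 : ℝ))
      (fun j hj => redMat_adj G (by simpa using hj)), Finset.sum_const, hcard]
    norm_num
  have hsn : ∀ i ∈ G.neighborFinset v, (redMat G *ᵥ x) i = 0 := by
    intro i hi
    have hvi : G.Adj v i := by simpa using hi
    rw [hmul, redMat_adj G hvi.symm, ← Finset.add_sum_erase _ _ hi, redMat_self,
      Finset.sum_congr rfl (g := fun _ => (1 : ℝ)), Finset.sum_const,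
      Finset.card_erase_of_mem hi, hcard]
    · norm_num
    · intro j hj
      rw [Finset.mem_erase] at hj
      exact redMat_nadj G hj.1.symm (no_tri htf hvi (by simpa using hj.2))
  have hz : star x ⬝ᵥ (redMat G *ᵥ x) = 0 := by
    refine Finset.sum_eq_zero fun i _ => ?_
    by_cases h1 : i = v
    · rw [h1, hsv, mul_zero]
    by_cases h2 : i ∈ G.neighborFinset v
    · rw [hsn i h2, mul_zero]
    · simp only [Pi.star_apply, hx, h1, h2, if_false]; simp
  rw [hP.dotProduct_mulVec_zero_iff] at hz
  have hww := congrFun hz w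
  rw [hmul, redMat_nadj G hne hw, Finset.sum_congr rfl
    (g := fun j => (1 : ℝ) - 6 * (if j ∈ G.neighborFinset w then 1 else 0)),
    Finset.sum_sub_distrib, ← Finset.mul_sum, Finset.sum_ite_mem, Finset.sum_const,
    Finset.sum_const, hcard] at hww
  · simp only [nsmul_eq_mul, Pi.zero_apply] at hww
    have : ((G.neighborFinset v ∩ G.neighborFinset w).card : ℝ) = 3 := by
      push_cast at hww; linarith
    exact_mod_cast this
  · intro j hj
    have hvj : G.Adj v j := by simpa using hj
    by_cases hwj : G.Adj w j
    · rw [redMat_adj G hwj]; simp [hwj]; norm_num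
    · rw [redMat_nadj G (by rintro rfl; exact hw hvj.symm) hwj]; simp [hwj]

theorem deg_13_nbr {m : ℕ} {G : SimpleGraph (Fin m)} [DecidableRel G.Adj]
    (hm : 66 ≤ m) (hP : (redMat G).PosSemidef) (htf : G.CliqueFree 3) {v : Fin m}
    (hv : G.degree v = 13) : m = 66 ∧ ∀ w ∈ G.neighborFinset v, G.degree w = 13 := by
  classical
  have hcard : (G.neighborFinset v).card = 13 := hv
  have hdc : ∑ j ∈ G.neighborFinset v, G.degree j
      = ∑ w, (G.neighborFinset v ∩ G.neighborFinset w).card := by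
    have := Finset.sum_card_bipartiteAbove_eq_sum_card_bipartiteBelow
      (s := G.neighborFinset v) (t := Finset.univ) G.Adj
    convert this using 2 with j _ w _
    · rw [← SimpleGraph.card_neighborFinset_eq_degree]
      congr 1; ext; simp [Finset.bipartiteAbove]
    · congr 1; ext; simp [Finset.bipartiteBelow, SimpleGraph.adj_comm]
  have hsplit : ∑ w, (G.neighborFinset v ∩ G.neighborFinset w).card = 13 + 3 * (m - 14) := by
    set T := insert v (G.neighborFinset v) with hT
    have hTc : T.card = 14 := by
      rw [hT, Finset.card_insert_of_notMem (by simp), hcard]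
    rw [← Finset.sum_add_sum_compl T, hT, Finset.sum_insert (by simp), ← hT, Finset.inter_self, hcard]
    rw [Finset.sum_eq_zero (s := G.neighborFinset v), Finset.sum_const_nat (m := 3),
      Finset.card_compl, hTc, Fintype.card_fin]
    · ring
    · intro w hw
      rw [hT, Finset.mem_compl, Finset.mem_insert, SimpleGraph.mem_neighborFinset, not_or] at hw
      exact three_common hP htf hv hw.1 (fun h => hw.2 h.symm)
    · intro w hw
      rw [Finset.card_eq_zero, Finset.eq_empty_iff_forall_notMem]
      intro j hj
      rw [SimpleGraph.mem_neighborFinset] at hw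
      rw [Finset.mem_inter, SimpleGraph.mem_neighborFinset, SimpleGraph.mem_neighborFinset] at hj
      exact no_tri htf hw hj.1 hj.2
  have hle : ∑ j ∈ G.neighborFinset v, G.degree j ≤ ∑ j ∈ G.neighborFinset v, 13 :=
    Finset.sum_le_sum fun j _ => deg_le_13 hP htf j
  have h169 : ∑ j ∈ G.neighborFinset v, 13 = 169 := by rw [Finset.sum_const, hcard]; rfl
  have hm66 : m = 66 := by omega
  have hn : ∀ j ∈ G.neighborFinset v, G.degree j = 13 := by
    rw [← Finset.sum_eq_sum_iff_of_le fun j _ => deg_le_13 hP htf j]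
    omega
  exact ⟨hm66, hn⟩

theorem deg_13_reg {m : ℕ} {G : SimpleGraph (Fin m)} [DecidableRel G.Adj]
    (hm : 66 ≤ m) (hP : (redMat G).PosSemidef) (htf : G.CliqueFree 3) {v : Fin m}
    (hv : G.degree v = 13) (w : Fin m) : G.degree w = 13 := by
  classical
  have hn := (deg_13_nbr hm hP htf hv).2
  by_cases h1 : w = v
  · rw [h1, hv]
  by_cases h2 : G.Adj v w
  · exact hn w (by simpa using h2)
  have h3 := three_common hP htf hv h1 (fun h => h2 h.symm)
  obtain ⟨j, hj⟩ : (G.neighborFinset v ∩ G.neighborFinset w).Nonempty := by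
    rw [← Finset.card_pos]; omega
  rw [Finset.mem_inter, SimpleGraph.mem_neighborFinset, SimpleGraph.mem_neighborFinset] at hj
  exact (deg_13_nbr hm hP htf (hn j (by simpa using hj.1))).2 w (by simpa using hj.2.symm)

theorem isSRG_of_deg_13 {G : SimpleGraph (Fin 66)} [DecidableRel G.Adj]
    (hP : (redMat G).PosSemidef) (htf : G.CliqueFree 3) {v : Fin 66}
    (hv : G.degree v = 13) : G.IsSRGWith 66 13 0 3 where
  card := by simp
  regular := deg_13_reg le_rfl hP htf hv
  of_adj := by
    intro a b hab
    rw [Fintype.card_eq_zero_iff]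
    refine ⟨fun ⟨c, hc⟩ => ?_⟩
    rw [SimpleGraph.mem_commonNeighbors] at hc
    exact no_tri htf hab hc.1 hc.2
  of_not_adj := by
    intro a b hne hab
    rw [← three_common hP htf (deg_13_reg le_rfl hP htf hv a) hne.symm (fun h => hab h.symm),
      ← Set.toFinset_card]
    congr 1
    ext c
    simp [SimpleGraph.mem_commonNeighbors]

theorem trace_idem {n : ℕ} (P : Matrix (Fin n) (Fin n) ℝ) (h : P * P = P) :
    ∃ k : ℕ, P.trace = k := by
  have hI : IsIdempotentElem (Matrix.toLin' P) := by
    unfold IsIdempotentElem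
    rw [Module.End.mul_eq_comp, ← Matrix.toLin'_mul, h]
  refine ⟨Module.finrank ℝ (LinearMap.range (Matrix.toLin' P)), ?_⟩
  rw [← (LinearMap.IsIdempotentElem.isProj_range _ hI).trace, Matrix.trace_toLin'_eq]

theorem no_srg {G : SimpleGraph (Fin 66)} [DecidableRel G.Adj] (h : G.IsSRGWith 66 13 0 3) :
    False := by
  set A := G.adjMatrix ℝ with hA
  set J : Matrix (Fin 66) (Fin 66) ℝ := Matrix.of fun _ _ => 1 with hJ
  have hA2 : A * A = 10 • (1 : Matrix (Fin 66) (Fin 66) ℝ) - 3 • A + 3 • J := by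
    rw [← sq, h.matrix_eq, ← hA]
    ext i j
    simp only [Matrix.add_apply, Matrix.sub_apply, Matrix.smul_apply]
    by_cases hij : i = j
    · subst hij; simp [hA, hJ]; norm_num
    · by_cases hadj : G.Adj i j <;> simp [hA, hJ, hij, hadj]
  have hAJ : A * J = 13 • J := by
    ext i j
    have : (G.neighborFinset i).card = 13 := h.regular i
    simp [hA, hJ, SimpleGraph.adjMatrix_mul_apply, this]
  have hJA : J * A = 13 • J := by
    ext i j
    have : (G.neighborFinset j).card = 13 := h.regular j
    simp [hA, hJ, SimpleGraph.mul_adjMatrix_apply, this]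
  have hJJ : J * J = 66 • J := by
    ext i j
    simp [hJ, Matrix.mul_apply]
  obtain ⟨k, hk⟩ := trace_idem ((1 / 42 : ℝ) • (12 • (1 : Matrix (Fin 66) (Fin 66) ℝ) - 6 • A + J)) (by
    simp only [Matrix.smul_mul, Matrix.mul_smul, mul_add, add_mul, mul_sub, sub_mul, hA2, hAJ, hJA,
      hJJ, mul_one, one_mul]
    module)
  have ht : A.trace = 0 := by simp [hA]
  have hJt : J.trace = 66 := by simp [hJ, Matrix.trace]
  simp only [Matrix.trace_smul, Matrix.trace_add, Matrix.trace_sub, Matrix.trace_one, ht, hJt,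
    Fintype.card_fin] at hk
  norm_num at hk
  have : (143 : ℝ) = ((7 * k : ℕ) : ℝ) := by push_cast; linarith
  have h2 : 143 = 7 * k := by exact_mod_cast this
  omega

theorem no_K23 {m : ℕ} {G : SimpleGraph (Fin m)} [DecidableRel G.Adj] (hm : 66 ≤ m)
    (hP : (redMat G).PosSemidef) (hd : ∀ v, G.degree v ≤ 12)
    (φ : SimpleGraph.Embedding (completeBipartiteGraph (Fin 2) (Fin 3)) G) : False := by
  classical
  set K : Finset (Fin m) := Finset.univ.map φ.toEmbedding with hK
  have hKc : K.card = 5 := by simp [hK]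
  have hmem : ∀ z, φ z ∈ K := fun z => by simp [hK]
  have ha : ∀ i, (G.neighborFinset (φ (.inl i)) \ K).card ≤ 9 := by
    intro i
    have h1 := Finset.card_sdiff_add_card_inter (G.neighborFinset (φ (.inl i))) K
    have h2 : (Finset.univ.map (Function.Embedding.inr.trans φ.toEmbedding)).card ≤
        (G.neighborFinset (φ (.inl i)) ∩ K).card := by
      refine Finset.card_le_card fun z hz => ?_
      simp only [Finset.mem_map, Finset.mem_univ, true_and] at hz
      obtain ⟨j, rfl⟩ := hz
      exact Finset.mem_inter.2 ⟨by simp, hmem _⟩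
    have h3 : (G.neighborFinset (φ (.inl i))).card ≤ 12 := hd _
    simp only [Finset.card_map, Finset.card_univ, Fintype.card_fin] at h2
    omega
  have hb : ∀ i, (G.neighborFinset (φ (.inr i)) \ K).card ≤ 10 := by
    intro i
    have h1 := Finset.card_sdiff_add_card_inter (G.neighborFinset (φ (.inr i))) K
    have h2 : (Finset.univ.map (Function.Embedding.inl.trans φ.toEmbedding)).card ≤
        (G.neighborFinset (φ (.inr i)) ∩ K).card := by
      refine Finset.card_le_card fun z hz => ?_
      simp only [Finset.mem_map, Finset.mem_univ, true_and] at hz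
      obtain ⟨j, rfl⟩ := hz
      exact Finset.mem_inter.2 ⟨by simp, hmem _⟩
    have h3 : (G.neighborFinset (φ (.inr i))).card ≤ 12 := hd _
    simp only [Finset.card_map, Finset.card_univ, Fintype.card_fin] at h2
    omega
  set U : Finset (Fin m) :=
    K ∪ Finset.univ.biUnion (fun z => G.neighborFinset (φ z) \ K) with hU
  have hUc : U.card ≤ 53 := by
    have h1 : (Finset.univ.biUnion (fun z => G.neighborFinset (φ z) \ K)).card ≤
        ∑ z, (G.neighborFinset (φ z) \ K).card := Finset.card_biUnion_le
    rw [Fintype.sum_sum_type, Fin.sum_univ_two, Fin.sum_univ_three] at h1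
    have h2 := Finset.card_union_le K
      (Finset.univ.biUnion (fun z => G.neighborFinset (φ z) \ K))
    have := ha 0; have := ha 1; have := hb 0; have := hb 1; have := hb 2
    rw [← hU] at h2
    omega
  have hUc' : 11 ≤ Uᶜ.card := by
    rw [Finset.card_compl, Fintype.card_fin]; omega
  obtain ⟨H, hH, hHc⟩ := Finset.exists_subset_card_eq hUc'
  have e : Fin 11 ≃ H := (Finset.equivFinOfCardEq hHc).symm
  have hnK : ∀ i, (e i : Fin m) ∉ K := fun i h => by
    have := hH (e i).2
    rw [Finset.mem_compl] at this
    exact this (Finset.mem_union_left _ h)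
  have hnadj : ∀ z i, ¬ G.Adj (φ z) (e i) := fun z i h => by
    have := hH (e i).2
    rw [Finset.mem_compl] at this
    refine this (Finset.mem_union_right _ (Finset.mem_biUnion.2 ⟨z, Finset.mem_univ _, ?_⟩))
    exact Finset.mem_sdiff.2 ⟨by simpa using h, hnK i⟩
  have hne : ∀ z i, φ z ≠ (e i : Fin m) := fun z i h => hnK i (h ▸ hmem z)
  have h1 : ∀ z i, redMat G (φ z) (e i) = 1 := fun z i => redMat_nadj G (hne z i) (hnadj z i)
  have h2 : ∀ z i, redMat G (e i) (φ z) = 1 := fun z i =>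
    redMat_nadj G (hne z i).symm (fun h => hnadj z i h.symm)
  have h3 : ∀ i j, redMat G (e i) (e j) ≤ if i = j then 13 else 1 := fun i j => by
    split_ifs with h
    · rw [h, redMat_self]
    · have hne' : (e i : Fin m) ≠ e j := fun h' => h (e.injective (Subtype.ext h'))
      by_cases hadj : G.Adj (e i) (e j)
      · rw [redMat_adj G hadj]; norm_num
      · rw [redMat_nadj G hne' hadj]
  have haa : ∀ i j, redMat G (φ (.inl i)) (φ (.inl j)) = if i = j then 13 else 1 := fun i j => by
    split_ifs with h
    · rw [h, redMat_self]
    · exact redMat_nadj G (by simpa using h) (by simp)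
  have hbb : ∀ i j, redMat G (φ (.inr i)) (φ (.inr j)) = if i = j then 13 else 1 := fun i j => by
    split_ifs with h
    · rw [h, redMat_self]
    · exact redMat_nadj G (by simpa using h) (by simp)
  have hab : ∀ i j, redMat G (φ (.inl i)) (φ (.inr j)) = -5 := fun i j => redMat_adj G (by simp)
  have hba : ∀ i j, redMat G (φ (.inr i)) (φ (.inl j)) = -5 := fun i j => redMat_adj G (by simp)
  have hq := redMat_quad hP (Sum.elim φ (fun i => (e i : Fin m)))
    (Sum.elim (Sum.elim (fun _ => 5) (fun _ => 4)) (fun _ => -1))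
  have hee : ∑ i, ∑ j, redMat G (e i) (e j) ≤ ∑ i : Fin 11, ∑ j : Fin 11, if i = j then 13 else 1 :=
    Finset.sum_le_sum fun i _ => Finset.sum_le_sum fun j _ => h3 i j
  simp [Finset.sum_ite, Finset.filter_eq, Finset.filter_ne] at hee
  simp [Fintype.sum_sum_type, h1, h2, haa, hab, hba, hbb, Finset.sum_ite, Finset.filter_eq,
    Finset.filter_ne] at hq
  rw [Finset.sum_add_distrib] at hq
  simp at hq
  linarith

/-- Let `G` be a triangle-free graph of order `m ≥ 66` with
`λ_min(S(G ∪ 2K₂)) ≥ -5`. Then the maximum degree of `G` is at most `12`, and `G` contains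
no induced `K_{2,3}`. -/
theorem stmt_18 {m : ℕ} (G : SimpleGraph (Fin m)) (hm : 66 ≤ m) (htf : G.CliqueFree 3)
    (hmin : -5 ≤ minSeidelEig (G ⊕g nK2 2)) :
    (∀ v, (G.neighborSet v).ncard ≤ 12) ∧
      ¬ Nonempty (SimpleGraph.Embedding (completeBipartiteGraph (Fin 2) (Fin 3)) G) := by
  classical
  have hP := redMat_psd G hmin
  have hd : ∀ v, G.degree v ≤ 12 := by
    intro v
    have h13 := deg_le_13 hP htf v
    by_contra hlt
    have hv : G.degree v = 13 := by omega
    obtain rfl := (deg_13_nbr hm hP htf hv).1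
    exact no_srg (isSRG_of_deg_13 hP htf hv)
  refine ⟨fun v => ?_, fun ⟨φ⟩ => no_K23 hm hP hd φ⟩
  rw [Set.ncard_eq_toFinset_card']
  exact hd v
end
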